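/- arXiv:1709.03936 — 2 statements merged into one kernel-verified Lean document; each statement's English description precedes it below -/
import Mathlib

section
/- Let n ≥ d+2 and set N = C(n,2) and C = C(d+1,2). The set M_{d,n} ⊆ ℂ^N is linearly isomorphic to the variety of complex symmetric (n−1)×(n−1) matrices of rank at most d (there is an invertible linear map between the ambient spaces carrying one onto the other). Consequently M_{d,n} is an algebraic variety defined over ℚ, it is irreducible, and its dimension is dn − C. Its singular locus consists exactly of the squared measurements m(p) of complex configurations p whose affine span has dimension strictly less than d. Moreover, if p is a generic complex configuration in ℂ^d or a generic configuration in ℝ^d, then m(p) is a generic point of M_{d,n}. -/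
/-- A (complex embedded affine) algebraic variety: the common zero set of a
finite collection of polynomials. -/
def IsVariety {ι : Type*} (V : Set (ι → ℂ)) : Prop :=
  ∃ S : Finset (MvPolynomial ι ℂ), V = {x | ∀ f ∈ S, MvPolynomial.eval x f = 0}

/-- A variety defined over ℚ: cut out by polynomials with rational coefficients. -/
def IsQVariety {ι : Type*} (V : Set (ι → ℂ)) : Prop :=
  ∃ S : Finset (MvPolynomial ι ℚ), V = {x | ∀ f ∈ S, MvPolynomial.aeval x f = 0}

/-- An irreducible variety: a nonempty variety that is not a union of two proper
subvarieties. -/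
def IsIrrVariety {ι : Type*} (V : Set (ι → ℂ)) : Prop :=
  IsVariety V ∧ V.Nonempty ∧
    ∀ V₁ V₂ : Set (ι → ℂ), IsVariety V₁ → IsVariety V₂ → V = V₁ ∪ V₂ → (V = V₁ ∨ V = V₂)

/-- A generic point of a variety `V`: a point of `V` whose coordinates satisfy no
polynomial equation with rational coefficients except those satisfied by every
point of `V`. -/
def IsGenericPt {ι : Type*} (V : Set (ι → ℂ)) (x : ι → ℂ) : Prop :=
  x ∈ V ∧ ∀ f : MvPolynomial ι ℚ, MvPolynomial.aeval x f = 0 →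
    ∀ y ∈ V, MvPolynomial.aeval y f = 0
/-- Edges of the complete graph `K_n`: unordered pairs of distinct vertices.
There are `N = C(n,2)` of them, and they index the coordinates of `ℂ^N`. -/
abbrev Edge (n : ℕ) : Type := {e : Sym2 (Fin n) // ¬ e.IsDiag}

/-- Complex squared length along an edge: `m_ij(p) = Σ_k (p_i^k − p_j^k)²`
(complex squares, no conjugation). -/
noncomputable def cSqLen {n d : ℕ} (p : Fin n → Fin d → ℂ) : Sym2 (Fin n) → ℂ :=
  Sym2.lift ⟨fun i j => ∑ k, (p i k - p j k) ^ 2,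
    fun i j => Finset.sum_congr rfl fun k _ => by ring⟩

/-- The squared measurement variety `M_{d,n}`: the image of the squared
measurement map over all complex configurations of `n` points in ℂ^d. -/
def Mvar (d n : ℕ) : Set (Edge n → ℂ) :=
  {w | ∃ p : Fin n → Fin d → ℂ, ∀ e : Edge n, w e = cSqLen p e.val}

/-- The coordinate-wise squaring map `s`. -/
def sqMap {n : ℕ} (w : Edge n → ℂ) : Edge n → ℂ := fun e => w e ^ 2

/-- The unsquared measurement variety `L_{d,n} = s⁻¹(M_{d,n})`. -/
def Lvar (d n : ℕ) : Set (Edge n → ℂ) := sqMap ⁻¹' Mvar d n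
/-- Dimension of a variety `V`, as the supremum of lengths of chains of
irreducible subvarieties of `V` (Krull dimension of the poset of irreducible
subvarieties contained in `V`). -/
noncomputable def varDim {ι : Type*} (V : Set (ι → ℂ)) : WithBot ℕ∞ :=
  Order.krullDim {W : Set (ι → ℂ) // IsIrrVariety W ∧ W ⊆ V}

/-- Local dimension of `V` at a point `x`: the dimension of the
highest-dimensional irreducible component of `V` containing `x` (Krull dimension
of the poset of irreducible subvarieties of `V` containing `x`). -/
noncomputable def localDim {ι : Type*} (V : Set (ι → ℂ)) (x : ι → ℂ) : WithBot ℕ∞ :=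
  Order.krullDim {W : Set (ι → ℂ) // IsIrrVariety W ∧ W ⊆ V ∧ x ∈ W}

/-- The Zariski tangent space of `V` at `x`: the kernel of the Jacobian, at `x`,
of the ideal of all polynomials vanishing on `V`. -/
noncomputable def zTangent {ι : Type*} [Fintype ι] (V : Set (ι → ℂ)) (x : ι → ℂ) :
    Submodule ℂ (ι → ℂ) where
  carrier := {v | ∀ f : MvPolynomial ι ℂ, (∀ y ∈ V, MvPolynomial.eval y f = 0) →
      ∑ i, v i * MvPolynomial.eval x (MvPolynomial.pderiv i f) = 0}
  add_mem' := by
    intro a b ha hb f hf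
    have h1 := ha f hf
    have h2 := hb f hf
    simp only [Pi.add_apply, add_mul]
    rw [Finset.sum_add_distrib, h1, h2, add_zero]
  zero_mem' := by
    intro f hf
    simp
  smul_mem' := by
    intro c a ha f hf
    have h1 := ha f hf
    simp only [Pi.smul_apply, smul_eq_mul, mul_assoc]
    rw [← Finset.mul_sum, h1, mul_zero]

/-- An (algebraically) singular point of `V`: a point of `V` where the dimension
of the Zariski tangent space differs from the local dimension. -/
def IsSingularPt {ι : Type*} [Fintype ι] (V : Set (ι → ℂ)) (x : ι → ℂ) : Prop :=
  x ∈ V ∧ (Module.finrank ℂ (zTangent V x) : WithBot ℕ∞) ≠ localDim V x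

/-- Squared Euclidean length along an edge of a real configuration. -/
noncomputable def sqLenR {n d : ℕ} (p : Fin n → Fin d → ℝ) : Sym2 (Fin n) → ℝ :=
  Sym2.lift ⟨fun i j => ∑ k, (p i k - p j k) ^ 2,
    fun i j => Finset.sum_congr rfl fun k _ => by ring⟩

/-- A generic configuration of `n` points in ℝ^d. -/
def GenericConfig {n d : ℕ} (p : Fin n → Fin d → ℝ) : Prop :=
  ∀ f : MvPolynomial (Fin n × Fin d) ℚ, f ≠ 0 →
    MvPolynomial.aeval (fun ik : Fin n × Fin d => p ik.1 ik.2) f ≠ 0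

/-- A generic complex configuration of `n` points in ℂ^d. -/
def GenericConfigC {n d : ℕ} (p : Fin n → Fin d → ℂ) : Prop :=
  ∀ f : MvPolynomial (Fin n × Fin d) ℚ, f ≠ 0 →
    MvPolynomial.aeval (fun ik : Fin n × Fin d => p ik.1 ik.2) f ≠ 0

/-- The space of complex symmetric `m × m` matrices, as a submodule of the space
of all `m × m` complex matrices. -/
noncomputable def symSub (m : ℕ) : Submodule ℂ (Matrix (Fin m) (Fin m) ℂ) where
  carrier := {A | A.IsSymm}
  add_mem' := by
    intro A B hA hB
    simp only [Set.mem_setOf_eq, Matrix.IsSymm, Matrix.transpose_add] at *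
    rw [hA, hB]
  zero_mem' := by
    simp only [Set.mem_setOf_eq, Matrix.IsSymm, Matrix.transpose_zero]
  smul_mem' := by
    intro c A hA
    simp only [Set.mem_setOf_eq, Matrix.IsSymm, Matrix.transpose_smul] at *
    rw [hA]



namespace SMV
open MvPolynomial

/-- Zariski closure. -/
def zcl {ι : Type*} (Y : Set (ι → ℂ)) : Set (ι → ℂ) :=
  {x | ∀ f : MvPolynomial ι ℂ, (∀ y ∈ Y, eval y f = 0) → eval x f = 0}

/-- The vanishing ideal is prime. -/
def PrimeOn {ι : Type*} (Y : Set (ι → ℂ)) : Prop :=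
  Y.Nonempty ∧ ∀ f g : MvPolynomial ι ℂ, (∀ y ∈ Y, eval y f * eval y g = 0) →
    (∀ y ∈ Y, eval y f = 0) ∨ (∀ y ∈ Y, eval y g = 0)

lemma subset_zcl {ι : Type*} (Y : Set (ι → ℂ)) : Y ⊆ zcl Y := fun y hy _ hf => hf y hy

lemma isVariety_of_set {ι : Type*} [Finite ι] (S : Set (MvPolynomial ι ℂ)) :
    IsVariety {x | ∀ f ∈ S, eval x f = 0} := by
  obtain ⟨T, hT⟩ := (isNoetherian_def.1 (inferInstance :
    IsNoetherian (MvPolynomial ι ℂ) (MvPolynomial ι ℂ))) (Ideal.span S)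
  refine ⟨T, ?_⟩
  have key : ∀ (U : Set (MvPolynomial ι ℂ)) (x : ι → ℂ),
      (∀ f ∈ U, eval x f = 0) ↔ Ideal.span U ≤ RingHom.ker (eval x) := by
    intro U x
    rw [Ideal.span_le]
    exact Iff.rfl
  ext x
  have h2 : (∀ f ∈ T, eval x f = 0) ↔ (∀ f ∈ (T : Set (MvPolynomial ι ℂ)), eval x f = 0) := by simp
  simp only [Set.mem_setOf_eq]
  rw [h2, key, key]
  have : Ideal.span (T : Set (MvPolynomial ι ℂ)) = Ideal.span S := hT
  rw [this]

lemma isVariety_zcl {ι : Type*} [Finite ι] (Y : Set (ι → ℂ)) : IsVariety (zcl Y) :=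
  isVariety_of_set {f | ∀ y ∈ Y, eval y f = 0}

lemma zcl_subset {ι : Type*} {Y V : Set (ι → ℂ)} (hV : IsVariety V) (h : Y ⊆ V) : zcl Y ⊆ V := by
  obtain ⟨S, rfl⟩ := hV
  intro x hx f hf
  exact hx f (fun y hy => h hy f hf)

lemma zcl_eq {ι : Type*} {V : Set (ι → ℂ)} (hV : IsVariety V) : zcl V = V :=
  (zcl_subset hV le_rfl).antisymm (subset_zcl V)

lemma PrimeOn.irr_zcl {ι : Type*} [Finite ι] {Y : Set (ι → ℂ)} (hY : PrimeOn Y) :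
    IsIrrVariety (zcl Y) := by
  refine ⟨isVariety_zcl Y, hY.1.mono (subset_zcl Y), ?_⟩
  intro V₁ V₂ h1 h2 h
  by_contra hcon
  push Not at hcon
  obtain ⟨hn1, hn2⟩ := hcon
  have aux : ∀ V' : Set (ι → ℂ), IsVariety V' → V' ⊆ zcl Y → zcl Y ≠ V' →
      ∃ f : MvPolynomial ι ℂ, (∀ y ∈ V', eval y f = 0) ∧ ∃ y ∈ Y, eval y f ≠ 0 := by
    intro V' hV' hs hne
    by_contra hc
    push Not at hc
    apply hne
    refine (zcl_subset hV' ?_).antisymm hs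
    rw [← zcl_eq hV']
    intro y hy f hf
    exact hc f hf y hy
  obtain ⟨f, hf, y, hy, hfy⟩ := aux V₁ h1 (h ▸ Set.subset_union_left) hn1
  obtain ⟨g, hg, z, hz, hgz⟩ := aux V₂ h2 (h ▸ Set.subset_union_right) hn2
  rcases hY.2 f g (by
    intro u hu
    have : u ∈ V₁ ∪ V₂ := h ▸ subset_zcl Y hu
    rcases this with h' | h'
    · rw [hf u h', zero_mul]
    · rw [hg u h', mul_zero]) with h' | h'
  · exact hfy (h' y hy)
  · exact hgz (h' z hz)

lemma primeOn_of_irr {ι : Type*} [Finite ι] {W : Set (ι → ℂ)} (hW : IsIrrVariety W) :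
    PrimeOn W := by
  refine ⟨hW.2.1, ?_⟩
  intro f g hfg
  obtain ⟨S, hS⟩ := hW.1
  have v : ∀ h : MvPolynomial ι ℂ, IsVariety {x | x ∈ W ∧ eval x h = 0} := by
    intro h
    have := isVariety_of_set (insert h (S : Set (MvPolynomial ι ℂ)))
    convert this using 1
    ext x
    simp only [hS, Set.mem_setOf_eq, Set.mem_insert_iff, forall_eq_or_imp, Finset.mem_coe]
    tauto
  rcases hW.2.2 _ _ (v f) (v g) (by
    ext x
    constructor
    · intro hx
      rcases mul_eq_zero.1 (hfg x hx) with h | h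
      · exact Or.inl ⟨hx, h⟩
      · exact Or.inr ⟨hx, h⟩
    · rintro (h | h) <;> exact h.1) with h | h
  · left; intro y hy; rw [h] at hy; exact hy.2
  · right; intro y hy; rw [h] at hy; exact hy.2

/-- evaluation of a polynomial map -/
noncomputable def pm {κ ι : Type*} (Θ : ι → MvPolynomial κ ℂ) (z : κ → ℂ) : ι → ℂ :=
  fun i => eval z (Θ i)

lemma eval_pm {κ ι : Type*} (Θ : ι → MvPolynomial κ ℂ) (z : κ → ℂ) (f : MvPolynomial ι ℂ) :
    eval (pm Θ z) f = eval z (bind₁ Θ f) := by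
  unfold pm
  rw [← eval₂_id, ← eval₂_id, ← coe_eval₂Hom, ← coe_eval₂Hom]
  rw [eval₂Hom_bind₁]
  simp [eval₂_id]

lemma primeOn_range {κ ι : Type*} (Θ : ι → MvPolynomial κ ℂ) : PrimeOn (Set.range (pm Θ)) := by
  refine ⟨Set.range_nonempty _, ?_⟩
  intro f g h
  simp only [Set.forall_mem_range, eval_pm, ← map_mul] at h ⊢
  have h0 : bind₁ Θ f * bind₁ Θ g = 0 := by
    apply MvPolynomial.funext
    intro x; rw [← map_mul, h, map_zero]
  rcases mul_eq_zero.1 h0 with h | h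
  · left; intro x; rw [h, map_zero]
  · right; intro x; rw [h, map_zero]

/-- algebraic independence on a set -/
def IndepOn {ι : Type*} {k : ℕ} (W : Set (ι → ℂ)) (f : Fin k → MvPolynomial ι ℂ) : Prop :=
  ∀ F : MvPolynomial (Fin k) ℂ, (∀ y ∈ W, eval (fun j => eval y (f j)) F = 0) → F = 0

lemma eval_finSucc {k : ℕ} (F : MvPolynomial (Fin (k+1)) ℂ) (a : ℂ) (b : Fin k → ℂ) :
    eval (Fin.cons a b : Fin (k+1) → ℂ) F =
      Polynomial.eval a (Polynomial.map (eval b) (finSuccEquiv ℂ k F)) := by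
  rw [eval_eq_eval_mv_eval']

lemma IndepOn.step {ι : Type*} [Finite ι] {k : ℕ} {W W' : Set (ι → ℂ)} (f : Fin k → MvPolynomial ι ℂ)
    (hW : IsIrrVariety W) (hW' : IsIrrVariety W') (hlt : W ⊂ W') (h : IndepOn W f) :
    ∃ f' : Fin (k+1) → MvPolynomial ι ℂ, IndepOn W' f' := by
  obtain ⟨g, hg, y0, hy0, hgy0⟩ : ∃ g : MvPolynomial ι ℂ, (∀ y ∈ W, eval y g = 0) ∧
      ∃ y ∈ W', eval y g ≠ 0 := by
    by_contra hc
    push Not at hc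
    apply hlt.2
    rw [← zcl_eq hW.1]
    intro y hy f hf
    exact hc f hf y hy
  have hp := primeOn_of_irr hW'
  refine ⟨Fin.cons g f, ?_⟩
  have hcons : ∀ y, (fun j => eval y ((Fin.cons g f : Fin (k+1) → MvPolynomial ι ℂ) j)) =
      (Fin.cons (eval y g) (fun j => eval y (f j)) : Fin (k+1) → ℂ) := by
    intro y; funext j
    refine Fin.cases ?_ (fun i => ?_) j <;> simp
  -- claim by strong induction
  have claim : ∀ N : ℕ, ∀ P : Polynomial (MvPolynomial (Fin k) ℂ), P.natDegree ≤ N →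
      (∀ y ∈ W', Polynomial.eval (eval y g)
        (Polynomial.map (eval (fun j => eval y (f j))) P) = 0) → P = 0 := by
    intro N
    induction N with
    | zero =>
      intro P hP hv
      rw [Polynomial.eq_C_of_natDegree_le_zero hP] at hv ⊢
      have : P.coeff 0 = 0 := h _ (fun y hy => by simpa using hv y (hlt.1 hy))
      rw [this, map_zero]
    | succ N ih =>
      intro P hP hv
      have h0 : P.coeff 0 = 0 := by
        apply h
        intro y hy
        have := hv y (hlt.1 hy)
        rw [hg y hy, ← Polynomial.coeff_zero_eq_eval_zero, Polynomial.coeff_map] at this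
        exact this
      obtain ⟨Q, rfl⟩ := Polynomial.X_dvd_iff.2 h0
      by_cases hQ : Q = 0
      · rw [hQ, mul_zero]
      rw [ih Q ?_ ?_, mul_zero]
      · rw [Polynomial.natDegree_X_mul hQ] at hP
        omega
      · have h3 : ∀ y, Polynomial.eval (eval y g)
            (Polynomial.map (eval (fun j => eval y (f j))) Q) =
            eval y (aeval (Fin.cons g f : Fin (k+1) → MvPolynomial ι ℂ) ((finSuccEquiv ℂ k).symm Q)) := by
          intro y
          have := eval_finSucc ((finSuccEquiv ℂ k).symm Q) (eval y g) (fun j => eval y (f j))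
          rw [AlgEquiv.apply_symm_apply] at this
          rw [← this, ← hcons]
          exact (eval_pm (Fin.cons g f : Fin (k+1) → MvPolynomial ι ℂ) y _)
        rcases hp.2 g (aeval (Fin.cons g f : Fin (k+1) → MvPolynomial ι ℂ) ((finSuccEquiv ℂ k).symm Q)) (by
          intro y hy
          rw [← h3]
          have := hv y hy
          simpa using this) with h4 | h4
        · exact absurd (h4 y0 hy0) hgy0
        · intro y hy; rw [h3]; exact h4 y hy
  intro F hF
  have := claim _ (finSuccEquiv ℂ k F) le_rfl (by
    intro y hy
    rw [← eval_finSucc, ← hcons]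
    exact hF y hy)
  simpa using this

lemma card_le_of_indep {κ ι : Type*} [Fintype κ] {k : ℕ} (Θ : ι → MvPolynomial κ ℂ)
    (f : Fin k → MvPolynomial ι ℂ) (h : IndepOn (zcl (Set.range (pm Θ))) f) :
    k ≤ Fintype.card κ := by
  have hi : AlgebraicIndependent ℂ (fun j => bind₁ Θ (f j)) := by
    rw [algebraicIndependent_iff]
    intro F hF
    apply h
    intro y hy
    have e1 : ∀ y, eval (fun j => eval y (f j)) F = eval y (bind₁ f F) := fun y => eval_pm f y F
    rw [e1]
    apply hy
    rintro _ ⟨z, rfl⟩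
    rw [eval_pm, bind₁_bind₁]
    have h5 : bind₁ (fun j => bind₁ Θ (f j)) F = 0 := hF
    rw [h5, map_zero]
  have := hi.lift_cardinalMk_le_trdeg
  rw [MvPolynomial.trdeg_of_isDomain] at this
  simpa using this

lemma krullDim_le {κ ι : Type*} [Fintype κ] [Finite ι] (Θ : ι → MvPolynomial κ ℂ)
    (P : Set (ι → ℂ) → Prop) (hP : ∀ W, P W → IsIrrVariety W ∧ W ⊆ zcl (Set.range (pm Θ))) :
    Order.krullDim {W : Set (ι → ℂ) // P W} ≤ (Fintype.card κ : ℕ) := by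
  refine iSup_le fun p => ?_
  have : ∀ i : ℕ, (hi : i < p.length + 1) → ∃ f : Fin i → MvPolynomial ι ℂ, IndepOn (p ⟨i, hi⟩).1 f := by
    intro i
    induction i with
    | zero =>
      intro hi
      refine ⟨Fin.elim0, ?_⟩
      intro F hF
      obtain ⟨y, hy⟩ := (hP _ (p ⟨0, hi⟩).2).1.2.1
      have := hF y hy
      rw [eq_C_of_isEmpty F] at this ⊢
      simp at this
      simp [this]
    | succ i ih =>
      intro hi
      obtain ⟨f, hf⟩ := ih (by omega)
      refine IndepOn.step f (hP _ (p ⟨i, by omega⟩).2).1 (hP _ (p ⟨i+1, hi⟩).2).1 ?_ hf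
      have : p ⟨i, by omega⟩ < p ⟨i+1, hi⟩ := p.strictMono (by simp [Fin.lt_def])
      exact this
  obtain ⟨f, hf⟩ := this p.length (by omega)
  have h2 := card_le_of_indep Θ f (fun F hF => hf F (fun y hy => hF y ((hP _ (p _).2).2 hy)))
  exact_mod_cast h2

end SMV



namespace SMV
open Matrix

lemma exists_diag {α : Type*} [Fintype α] [DecidableEq α] (A : Matrix α α ℂ) (hA : A.IsSymm) :
    ∃ (g : Matrix α α ℂ) (w : α → ℂ), IsUnit g.det ∧ A = g * diagonal w * gᵀ := by
  have hB : LinearMap.IsSymm (Matrix.toBilin' A) := by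
    constructor
    intro x y
    simp only [Matrix.toBilin'_apply', RingHom.id_apply]
    rw [dotProduct_mulVec, ← mulVec_transpose, hA.eq, dotProduct_comm]
  obtain ⟨v, hv⟩ := LinearMap.BilinForm.exists_orthogonal_basis (K := ℂ) (V := α → ℂ)
    (B := Matrix.toBilin' A) hB
  let e : Fin (Module.finrank ℂ (α → ℂ)) ≃ α := Fintype.equivOfCardEq (by simp)
  let c := v.reindex e
  let b := Pi.basisFun ℂ α
  have h1 := LinearMap.BilinForm.toMatrix_mul_basis_toMatrix b c (Matrix.toBilin' A)
  have h2 : LinearMap.BilinForm.toMatrix b (Matrix.toBilin' A) = A := by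
    ext i j
    simp [LinearMap.BilinForm.toMatrix_apply, b, Matrix.toBilin'_single]
  have h3 : LinearMap.BilinForm.toMatrix c (Matrix.toBilin' A) =
      diagonal (fun i => Matrix.toBilin' A (c i) (c i)) := by
    ext i j
    rw [LinearMap.BilinForm.toMatrix_apply, diagonal_apply]
    split_ifs with h
    · rw [h]
    · have : e.symm i ≠ e.symm j := fun h' => h (e.symm.injective h')
      simpa [c] using hv this
  rw [h2, h3] at h1
  set h := b.toMatrix c with hh
  have hi : h * c.toMatrix b = 1 := b.toMatrix_mul_toMatrix_flip c
  refine ⟨(c.toMatrix b)ᵀ, fun i => Matrix.toBilin' A (c i) (c i), ?_, ?_⟩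
  · rw [det_transpose]
    exact IsUnit.of_mul_eq_one h.det (by rw [← det_mul, mul_eq_one_comm.1 hi, det_one])
  · rw [← h1, transpose_transpose]
    have hi' : (c.toMatrix b)ᵀ * hᵀ = 1 := by rw [← transpose_mul, hi, transpose_one]
    calc A = ((c.toMatrix b)ᵀ * hᵀ) * A * (h * c.toMatrix b) := by rw [hi, hi']; simp
      _ = _ := by simp only [Matrix.mul_assoc]

lemma exists_gram {α : Type*} [Fintype α] [DecidableEq α] {d : ℕ} (A : Matrix α α ℂ) (hA : A.IsSymm)
    (hr : A.rank ≤ d) : ∃ P : Matrix α (Fin d) ℂ, A = P * Pᵀ := by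
  obtain ⟨g, w, hg, rfl⟩ := exists_diag A hA
  rw [rank_mul_eq_left_of_isUnit_det _ _ (by rwa [det_transpose]),
    rank_mul_eq_right_of_isUnit_det _ _ hg, rank_diagonal] at hr
  obtain ⟨e⟩ : Nonempty ({i // w i ≠ 0} ↪ Fin d) := by
    rw [Function.Embedding.nonempty_iff_card_le]; simpa using hr
  choose s hs using fun i => IsAlgClosed.exists_pow_nat_eq (w i) (n := 2) (by norm_num)
  let E : Matrix α (Fin d) ℂ := Matrix.of fun i k => if h : w i ≠ 0 then (if e ⟨i, h⟩ = k then s i else 0) else 0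
  refine ⟨g * E, ?_⟩
  rw [transpose_mul]
  have : E * Eᵀ = diagonal w := by
    ext i j
    rw [mul_apply, diagonal_apply]
    simp only [transpose_apply, E, Matrix.of_apply]
    by_cases hi : w i ≠ 0
    · by_cases hj : w j ≠ 0
      · simp only [hi, hj, dite_true, not_false_eq_true, ne_eq]
        simp only [ite_mul, zero_mul, Finset.sum_ite_eq, Finset.mem_univ, if_true]
        by_cases hij : i = j
        · subst hij; simp [← hs, sq]
        · simp only [hij, if_false]
          rw [if_neg]
          · simp
          · intro h; have := e.injective h; simp at this; exact hij this.symm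
      · have : i ≠ j := by rintro rfl; exact hj hi
        simp [hj, this]
    · simp only [hi, dite_false, zero_mul, Finset.sum_const_zero]
      split_ifs
      · push Not at hi; exact hi.symm
      · rfl
  rw [Matrix.mul_assoc g E, ← Matrix.mul_assoc E, this, Matrix.mul_assoc]

lemma exists_rows {α β : Type*} [Fintype α] [Fintype β] {k : ℕ} (A : Matrix α β ℂ)
    (h : k ≤ A.rank) : ∃ r : Fin k → α, LinearIndependent ℂ (A.submatrix r id).row := by
  rw [rank_eq_finrank_span_row] at h
  obtain ⟨f, hf, -, hl⟩ := Submodule.exists_fun_fin_finrank_span_eq ℂ (Set.range A.row)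
  choose r hr using hf
  refine ⟨fun i => r (Fin.castLE h i), ?_⟩
  have := hl.comp (Fin.castLE h) (Fin.castLE_injective h)
  have e1 : (A.submatrix (fun i => r (Fin.castLE h i)) id).row = f ∘ Fin.castLE h := by
    funext i
    exact hr _
  rw [e1]
  exact this

lemma rank_le_iff {α : Type*} [Fintype α] [DecidableEq α] {d : ℕ} (A : Matrix α α ℂ) :
    A.rank ≤ d ↔ ∀ r c : Fin (d+1) → α, (A.submatrix r c).det = 0 := by
  constructor
  · intro h r c
    by_contra hne
    have h1 := rank_of_det_ne_zero hne
    have h2 := rank_submatrix_le A r c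
    simp at h1
    omega
  · intro h
    by_contra hlt
    push Not at hlt
    obtain ⟨r, hr⟩ := exists_rows A (k := d+1) hlt
    have h1 := hr.rank_matrix
    rw [Fintype.card_fin, ← rank_transpose] at h1
    obtain ⟨c, hc⟩ := exists_rows _ h1.ge
    have h2 := linearIndependent_rows_iff_isUnit.1 hc
    rw [isUnit_iff_isUnit_det] at h2
    have h3 := h r c
    rw [← det_transpose] at h3
    apply h2.ne_zero
    exact h3

lemma exists_extend {d r : ℕ} (P : Matrix (Fin d ⊕ Fin r) (Fin d) ℂ) (hP : P.rank = d) :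
    ∃ g : Matrix (Fin d ⊕ Fin r) (Fin d ⊕ Fin r) ℂ, IsUnit g.det ∧
      g * (fromRows (1 : Matrix (Fin d) (Fin d) ℂ) (0 : Matrix (Fin r) (Fin d) ℂ)) = P := by
  have hl : LinearIndependent ℂ P.col := by
    rw [linearIndependent_iff_card_eq_finrank_span, Fintype.card_fin]
    rw [rank_eq_finrank_span_cols] at hP
    exact hP.symm
  let b := Module.Basis.sumExtend hl
  have hfin : Finite (Fin d ⊕ Module.Basis.sumExtendIndex hl) := Module.Finite.finite_basis b
  have : Finite (Module.Basis.sumExtendIndex hl) := Finite.of_injective _ (Sum.inr_injective (α := Fin d))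
  have := Fintype.ofFinite (Module.Basis.sumExtendIndex hl)
  have hc : Fintype.card (Module.Basis.sumExtendIndex hl) = Fintype.card (Fin r) := by
    have := Module.finrank_eq_card_basis b
    simp at this ⊢
    omega
  let e := Fintype.equivOfCardEq hc
  let c := b.reindex ((Equiv.refl _).sumCongr e)
  have hcl : ∀ k, c (Sum.inl k) = P.col k := by
    intro k
    simp [c, b, Module.Basis.sumExtend]
    rfl
  refine ⟨(Pi.basisFun ℂ _).toMatrix c, ?_, ?_⟩
  · exact IsUnit.of_mul_eq_one (c.toMatrix (Pi.basisFun ℂ _)).det (by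
      rw [← det_mul, Module.Basis.toMatrix_mul_toMatrix_flip, det_one])
  · ext i k
    simp [mul_apply, Module.Basis.toMatrix_apply, hcl, Matrix.one_apply]

end SMV



namespace SMV
open Matrix

structure Good {ι : Type*} {α : Type*} (G : (ι → ℂ) →ₗ[ℂ] Matrix α α ℂ) : Prop where
  inj : Function.Injective G
  symm : ∀ w, (G w).IsSymm
  surj : ∀ A : Matrix α α ℂ, A.IsSymm → ∃ w, G w = A

/-- rank at most d -/
def RV {ι : Type*} {α : Type*} [Fintype α] (d : ℕ) (G : (ι → ℂ) →ₗ[ℂ] Matrix α α ℂ) : Set (ι → ℂ) :=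
  {w | (G w).rank ≤ d}

noncomputable def GP {ι : Type*} [Fintype ι] [DecidableEq ι] {α : Type*}
    (G : (ι → ℂ) →ₗ[ℂ] Matrix α α ℂ) : Matrix α α (MvPolynomial ι ℂ) :=
  Matrix.of fun a b => ∑ i, MvPolynomial.C (G (Pi.single i 1) a b) * MvPolynomial.X i

lemma GP_map {ι : Type*} [Fintype ι] [DecidableEq ι] {α : Type*}
    (G : (ι → ℂ) →ₗ[ℂ] Matrix α α ℂ) (w : ι → ℂ) : (GP G).map (MvPolynomial.eval w) = G w := by
  ext a b
  have : w = ∑ i, w i • (Pi.single i (1 : ℂ) : ι → ℂ) := by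
    ext j; simp [Finset.sum_apply, Pi.single_apply]
  conv_rhs => rw [this, map_sum]
  simp only [map_smul, Matrix.sum_apply, Matrix.smul_apply, Matrix.map_apply, GP, Matrix.of_apply, map_sum,
    map_mul, MvPolynomial.eval_C, MvPolynomial.eval_X, smul_eq_mul]
  exact Finset.sum_congr rfl fun i _ => mul_comm _ _

lemma isVariety_RV {ι : Type*} [Fintype ι] [DecidableEq ι] {α : Type*} [Fintype α] [DecidableEq α]
    (d : ℕ) (G : (ι → ℂ) →ₗ[ℂ] Matrix α α ℂ) : IsVariety (RV d G) := by
  have := isVariety_of_set (Set.range fun rc : (Fin (d+1) → α) × (Fin (d+1) → α) =>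
    ((GP G).submatrix rc.1 rc.2).det)
  convert this using 1
  ext w
  simp only [RV, Set.mem_setOf_eq, rank_le_iff, Set.forall_mem_range, Prod.forall]
  refine forall_congr' fun r => forall_congr' fun c => ?_
  rw [RingHom.map_det, RingHom.mapMatrix_apply, ← submatrix_map, GP_map]

lemma exists_param {ι : Type*} {α : Type*} [Fintype α] [DecidableEq α]
    {G : (ι → ℂ) →ₗ[ℂ] Matrix α α ℂ} (hG : Good G) {κ : Type*}
    (M : Matrix α α (MvPolynomial κ ℂ)) (hM : M.IsSymm) :
    ∃ Θ : ι → MvPolynomial κ ℂ, ∀ z, G (pm Θ z) = M.map (MvPolynomial.eval z) := by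
  obtain ⟨H, hH⟩ := LinearMap.exists_leftInverse_of_injective G (LinearMap.ker_eq_bot.2 hG.inj)
  refine ⟨fun i => ∑ a, ∑ b, MvPolynomial.C (H (Matrix.single a b 1) i) * M a b, ?_⟩
  intro z
  obtain ⟨w, hw⟩ := hG.surj (M.map (MvPolynomial.eval z)) (by
    ext a b; simp only [transpose_apply, map_apply]; rw [hM.apply])
  have : pm (fun i => ∑ a, ∑ b, MvPolynomial.C (H (Matrix.single a b 1) i) * M a b) z = w := by
    have h1 : H (G w) = w := by
      have := LinearMap.congr_fun hH w
      simpa using this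
    rw [← h1, hw]
    conv_rhs => rw [matrix_eq_sum_single (M.map (MvPolynomial.eval z))]
    ext i
    simp only [pm, map_sum, map_mul, MvPolynomial.eval_C, Finset.sum_apply]
    refine Finset.sum_congr rfl fun a _ => Finset.sum_congr rfl fun b _ => ?_
    have : Matrix.single a b ((M.map (MvPolynomial.eval z)) a b) =
      ((M.map (MvPolynomial.eval z)) a b) • Matrix.single a b (1:ℂ) := by simp
    rw [this, map_smul]
    simp [mul_comm]
  rw [this, hw]

lemma rank_gram_le {α : Type*} [Fintype α] {d : ℕ} (P : Matrix α (Fin d) ℂ) (Q : Matrix (Fin d) α ℂ) :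
    (P * Q).rank ≤ d :=
  (rank_mul_le_left _ _).trans (by simpa using rank_le_card_width P)

lemma isSymm_gram {α β R : Type*} [CommRing R] [Fintype β] (P : Matrix α β R) : (P * Pᵀ).IsSymm := by
  rw [Matrix.IsSymm, transpose_mul, transpose_transpose]

lemma primeOn_RV {ι : Type*} {α : Type*} [Fintype α] [DecidableEq α]
    {G : (ι → ℂ) →ₗ[ℂ] Matrix α α ℂ} (hG : Good G) (d : ℕ) : PrimeOn (RV d G) := by
  let P : Matrix α (Fin d) (MvPolynomial (α × Fin d) ℂ) := Matrix.of fun a k => MvPolynomial.X (a, k)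
  obtain ⟨Θ, hΘ⟩ := exists_param hG (P * Pᵀ) (isSymm_gram P)
  have hP : ∀ z : α × Fin d → ℂ, (P * Pᵀ).map (MvPolynomial.eval z) =
      (Matrix.of fun a k => z (a, k)) * (Matrix.of fun a k => z (a, k))ᵀ := by
    intro z
    rw [Matrix.map_mul]
    congr 1 <;> · ext a k; simp [P]
  have : RV d G = Set.range (pm Θ) := by
    ext w
    constructor
    · intro hw
      obtain ⟨Q, hQ⟩ := exists_gram (G w) (hG.symm w) hw
      refine ⟨fun ak => Q ak.1 ak.2, hG.inj ?_⟩
      rw [hΘ, hP, hQ]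
      rfl
    · rintro ⟨z, rfl⟩
      simp only [RV, Set.mem_setOf_eq, hΘ, hP]
      exact rank_gram_le _ _
  rw [this]
  exact primeOn_range Θ

lemma irr_RV {ι : Type*} [Fintype ι] [DecidableEq ι] {α : Type*} [Fintype α] [DecidableEq α]
    {G : (ι → ℂ) →ₗ[ℂ] Matrix α α ℂ} (hG : Good G) (d : ℕ) : IsIrrVariety (RV d G) := by
  have := (primeOn_RV hG d).irr_zcl
  rwa [zcl_eq (isVariety_RV d G)] at this

abbrev Kap (d r : ℕ) : Type := Sym2 (Fin d) ⊕ (Fin r × Fin d)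

def Smat {d r : ℕ} {R : Type*} (z : Kap d r → R) : Matrix (Fin d) (Fin d) R :=
  Matrix.of fun i j => z (Sum.inl s(i, j))

def Ymat {d r : ℕ} {R : Type*} (z : Kap d r → R) : Matrix (Fin r) (Fin d) R :=
  Matrix.of fun i j => z (Sum.inr (i, j))

def Tmat {d r : ℕ} {R : Type*} [CommRing R] (z : Kap d r → R) :
    Matrix (Fin d ⊕ Fin r) (Fin d ⊕ Fin r) R :=
  fromBlocks (Smat z) (Smat z * (Ymat z)ᵀ) (Ymat z * Smat z) (Ymat z * Smat z * (Ymat z)ᵀ)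

lemma Smat_symm {d r : ℕ} {R : Type*} (z : Kap d r → R) : (Smat z)ᵀ = Smat z := by
  ext i j; simp [Smat, Sym2.eq_swap]

lemma Tmat_symm {d r : ℕ} {R : Type*} [CommRing R] (z : Kap d r → R) : (Tmat z).IsSymm := by
  simp [Matrix.IsSymm, Tmat, fromBlocks_transpose, Smat_symm, Matrix.mul_assoc]

lemma Tmat_rank {d r : ℕ} (z : Kap d r → ℂ) : (Tmat z).rank ≤ d := by
  have : Tmat z = (fromRows (1 : Matrix (Fin d) (Fin d) ℂ) (Ymat z)) *
      (fromCols (Smat z) (Smat z * (Ymat z)ᵀ)) := by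
    rw [fromRows_mul_fromCols]
    simp [Tmat, Matrix.mul_assoc]
  rw [this]
  exact rank_gram_le _ _

lemma exists_kap {d r : ℕ} {R : Type*} (S : Matrix (Fin d) (Fin d) R) (hS : S.IsSymm) (Y : Matrix (Fin r) (Fin d) R) :
    ∃ z : Kap d r → R, Smat z = S ∧ Ymat z = Y := by
  refine ⟨Sum.elim (Sym2.lift ⟨fun i j => S i j, fun i j => hS.apply j i⟩) (fun ab => Y ab.1 ab.2), ?_, ?_⟩
  · ext i j; simp [Smat]
  · ext i j; simp [Ymat]

lemma Tmat_map {d r : ℕ} (z : Kap d r → ℂ) :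
    (Tmat (fun c => MvPolynomial.X c : Kap d r → MvPolynomial (Kap d r) ℂ)).map (MvPolynomial.eval z)
      = Tmat z := by
  have h1 : (Smat (fun c => MvPolynomial.X c : Kap d r → MvPolynomial (Kap d r) ℂ)).map
      (MvPolynomial.eval z) = Smat z := by ext i j; simp [Smat]
  have h2 : (Ymat (fun c => MvPolynomial.X c : Kap d r → MvPolynomial (Kap d r) ℂ)).map
      (MvPolynomial.eval z) = Ymat z := by ext i j; simp [Ymat]
  simp only [Tmat, fromBlocks_map, Matrix.map_mul, h1, h2, transpose_map]

lemma exists_theta {ι : Type*} {d r : ℕ}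
    {G : (ι → ℂ) →ₗ[ℂ] Matrix (Fin d ⊕ Fin r) (Fin d ⊕ Fin r) ℂ} (hG : Good G) :
    ∃ Θ : ι → MvPolynomial (Kap d r) ℂ, ∀ z, G (pm Θ z) = Tmat z := by
  obtain ⟨Θ, hΘ⟩ := exists_param hG _ (Tmat_symm (fun c => MvPolynomial.X c : Kap d r → MvPolynomial (Kap d r) ℂ))
  exact ⟨Θ, fun z => by rw [hΘ, Tmat_map]⟩

lemma RV_subset {ι : Type*} [Fintype ι] [DecidableEq ι] {d r : ℕ}
    {G : (ι → ℂ) →ₗ[ℂ] Matrix (Fin d ⊕ Fin r) (Fin d ⊕ Fin r) ℂ} (hG : Good G)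
    (Θ : ι → MvPolynomial (Kap d r) ℂ) (hΘ : ∀ z, G (pm Θ z) = Tmat z) :
    RV d G ⊆ zcl (Set.range (pm Θ)) := by
  intro w hw f hf
  rcases (primeOn_RV hG d).2 f (GP G).toBlocks₁₁.det (by
    intro y hy
    obtain ⟨P, hP⟩ := exists_gram (G y) (hG.symm y) hy
    rw [RingHom.map_det, RingHom.mapMatrix_apply]
    have h1 : (GP G).toBlocks₁₁.map (MvPolynomial.eval y) = (G y).toBlocks₁₁ := by
      rw [← GP_map G y]; rfl
    have hP' : P = fromRows P.toRows₁ P.toRows₂ := (fromRows_toRows P).symm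
    set P1 := P.toRows₁
    set P2 := P.toRows₂
    rw [hP', transpose_fromRows, fromRows_mul_fromCols] at hP
    rw [h1, hP, toBlocks_fromBlocks₁₁, det_mul, det_transpose]
    by_cases hu : P1.det = 0
    · simp [hu]
    · have hu' : IsUnit P1.det := isUnit_iff_ne_zero.2 hu
      obtain ⟨z, hz1, hz2⟩ := exists_kap (P1 * P1ᵀ) (isSymm_gram P1) (P2 * P1⁻¹)
      have : y = pm Θ z := by
        apply hG.inj
        rw [hΘ, hP, Tmat, hz1, hz2]
        have e2 : P2 * P1⁻¹ * (P1 * P1ᵀ) = P2 * P1ᵀ := by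
          rw [Matrix.mul_assoc, nonsing_inv_mul_cancel_left _ _ hu']
        have e1 : P1 * P1ᵀ * (P2 * P1⁻¹)ᵀ = P1 * P2ᵀ := by
          have := congrArg transpose e2
          simpa [Matrix.mul_assoc] using this
        have e3 : P2 * P1⁻¹ * (P1 * P1ᵀ) * (P2 * P1⁻¹)ᵀ = P2 * P2ᵀ := by
          rw [Matrix.mul_assoc, e1, Matrix.mul_assoc, nonsing_inv_mul_cancel_left _ _ hu']
        rw [e1, e3, e2]
      rw [hf y (this ▸ ⟨z, rfl⟩), zero_mul]) with h | h
  · exact h w hw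
  · exfalso
    obtain ⟨z, hz1, hz2⟩ := exists_kap (1 : Matrix (Fin d) (Fin d) ℂ) isSymm_one (0 : Matrix (Fin r) (Fin d) ℂ)
    have := h (pm Θ z) (by simp only [RV, Set.mem_setOf_eq, hΘ]; exact Tmat_rank z)
    rw [RingHom.map_det, RingHom.mapMatrix_apply] at this
    have h1 : (GP G).toBlocks₁₁.map (MvPolynomial.eval (pm Θ z)) = (G (pm Θ z)).toBlocks₁₁ := by
      rw [← GP_map G (pm Θ z)]; rfl
    rw [h1, hΘ, Tmat, toBlocks_fromBlocks₁₁, hz1] at this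
    simp at this

lemma varDim_le {ι : Type*} [Fintype ι] [DecidableEq ι] {d r : ℕ}
    {G : (ι → ℂ) →ₗ[ℂ] Matrix (Fin d ⊕ Fin r) (Fin d ⊕ Fin r) ℂ} (hG : Good G) :
    varDim (RV d G) ≤ (Fintype.card (Kap d r) : ℕ) := by
  obtain ⟨Θ, hΘ⟩ := exists_theta hG
  exact krullDim_le Θ _ fun W hW => ⟨hW.1, hW.2.trans (RV_subset hG Θ hΘ)⟩

lemma localDim_le {ι : Type*} (V : Set (ι → ℂ)) (x : ι → ℂ) : localDim V x ≤ varDim V := by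
  refine Order.krullDim_le_of_strictMono
    (fun W : {W : Set (ι → ℂ) // IsIrrVariety W ∧ W ⊆ V ∧ x ∈ W} =>
      (⟨W.1, W.2.1, W.2.2.1⟩ : {W : Set (ι → ℂ) // IsIrrVariety W ∧ W ⊆ V})) ?_
  intro a b h
  exact h

lemma exists_q {ι : Type*} [Fintype ι] [DecidableEq ι] {d r : ℕ}
    {G : (ι → ℂ) →ₗ[ℂ] Matrix (Fin d ⊕ Fin r) (Fin d ⊕ Fin r) ℂ}
    (Θ : ι → MvPolynomial (Kap d r) ℂ) (hΘ : ∀ z, G (pm Θ z) = Tmat z) (c : Kap d r) :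
    ∃ q : MvPolynomial ι ℂ, ∀ z, MvPolynomial.eval (pm Θ z) q = (Smat z).det * z c := by
  have h1 : ∀ z, (GP G).toBlocks₁₁.map (MvPolynomial.eval (pm Θ z)) = Smat z := by
    intro z
    have : (GP G).toBlocks₁₁.map (MvPolynomial.eval (pm Θ z)) = (G (pm Θ z)).toBlocks₁₁ := by
      rw [← GP_map G (pm Θ z)]; rfl
    rw [this, hΘ, Tmat, toBlocks_fromBlocks₁₁]
  have h2 : ∀ z, (GP G).toBlocks₂₁.map (MvPolynomial.eval (pm Θ z)) = Ymat z * Smat z := by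
    intro z
    have : (GP G).toBlocks₂₁.map (MvPolynomial.eval (pm Θ z)) = (G (pm Θ z)).toBlocks₂₁ := by
      rw [← GP_map G (pm Θ z)]; rfl
    rw [this, hΘ, Tmat, toBlocks_fromBlocks₂₁]
  rcases c with s | ⟨a, k⟩
  · induction s with | _ i j
    refine ⟨(GP G).toBlocks₁₁.det * (GP G).toBlocks₁₁ i j, fun z => ?_⟩
    rw [map_mul, RingHom.map_det, RingHom.mapMatrix_apply, h1]
    have := congrFun (congrFun (h1 z) i) j
    rw [map_apply] at this
    rw [this]
    rfl
  · refine ⟨((GP G).toBlocks₂₁ * (GP G).toBlocks₁₁.adjugate) a k, fun z => ?_⟩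
    have : ((GP G).toBlocks₂₁ * (GP G).toBlocks₁₁.adjugate).map (MvPolynomial.eval (pm Θ z)) =
        (Smat z).det • Ymat z := by
      have h3 := RingHom.map_adjugate (MvPolynomial.eval (pm Θ z)) (GP G).toBlocks₁₁
      rw [RingHom.mapMatrix_apply, RingHom.mapMatrix_apply] at h3
      rw [Matrix.map_mul, h3, h1, h2, Matrix.mul_assoc, mul_adjugate]
      simp
    have := congrFun (congrFun this a) k
    rw [map_apply] at this
    rw [this]
    rfl

end SMV



namespace SMV
open Matrix

lemma le_localDim {ι : Type*} [Fintype ι] [DecidableEq ι] {d r : ℕ}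
    {G : (ι → ℂ) →ₗ[ℂ] Matrix (Fin d ⊕ Fin r) (Fin d ⊕ Fin r) ℂ} (hG : Good G)
    (w0 : ι → ℂ) (hw0 : G w0 = fromBlocks 1 0 0 0) :
    ((Fintype.card (Kap d r) : ℕ) : WithBot ℕ∞) ≤ localDim (RV d G) w0 := by
  obtain ⟨Θ, hΘ⟩ := exists_theta hG
  obtain ⟨z0, hz1, hz2⟩ := exists_kap (1 : Matrix (Fin d) (Fin d) ℂ) isSymm_one (0 : Matrix (Fin r) (Fin d) ℂ)
  have hw0' : pm Θ z0 = w0 := by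
    apply hG.inj
    rw [hΘ, hw0, Tmat, hz1, hz2]
    simp
  let e := Fintype.equivFin (Kap d r)
  let B : ℕ → Kap d r → MvPolynomial (Kap d r) ℂ := fun k c =>
    if (e c : ℕ) < k then MvPolynomial.X c else MvPolynomial.C (z0 c)
  let tr : ℕ → (Kap d r → ℂ) → (Kap d r → ℂ) := fun k z c => if (e c : ℕ) < k then z c else z0 c
  have hB : ∀ k z, pm (B k) z = tr k z := by
    intro k z
    funext c
    simp only [pm, B, tr]
    split_ifs <;> simp
  let Θk : ℕ → ι → MvPolynomial (Kap d r) ℂ := fun k i => MvPolynomial.bind₁ (B k) (Θ i)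
  have hΘk : ∀ k z, pm (Θk k) z = pm Θ (tr k z) := by
    intro k z
    rw [← hB]
    funext i
    exact (eval_pm (B k) z (Θ i)).symm
  let W : ℕ → Set (ι → ℂ) := fun k => zcl (Set.range (pm (Θk k)))
  have hirr : ∀ k, IsIrrVariety (W k) := fun k => (primeOn_range _).irr_zcl
  have hsub : ∀ k, W k ⊆ RV d G := by
    intro k
    apply zcl_subset (isVariety_RV d G)
    rintro _ ⟨z, rfl⟩
    rw [hΘk]
    change (G _).rank ≤ d
    rw [hΘ]
    exact Tmat_rank _
  have htr0 : ∀ k, tr k z0 = z0 := by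
    intro k; funext c; simp [tr]
  have hmem : ∀ k, w0 ∈ W k := by
    intro k
    apply subset_zcl
    exact ⟨z0, by rw [hΘk, htr0, hw0']⟩
  have hlt : ∀ k, k < Fintype.card (Kap d r) → W k < W (k+1) := by
    intro k hk
    have hle : W k ⊆ W (k+1) := by
      apply zcl_subset (isVariety_zcl _)
      rintro _ ⟨z, rfl⟩
      apply subset_zcl
      refine ⟨tr k z, ?_⟩
      rw [hΘk, hΘk]
      congr 1
      funext c
      simp only [tr]
      split_ifs <;> first | rfl | omega
    refine ⟨hle, ?_⟩
    intro hge
    let c := e.symm ⟨k, hk⟩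
    have hc : (e c : ℕ) = k := by simp [c]
    obtain ⟨q, hq⟩ := exists_q Θ hΘ c
    let D := (GP G).toBlocks₁₁.det
    have hD : ∀ z, MvPolynomial.eval (pm Θ z) D = (Smat z).det := by
      intro z
      have h1 : (GP G).toBlocks₁₁.map (MvPolynomial.eval (pm Θ z)) = (G (pm Θ z)).toBlocks₁₁ := by
        rw [← GP_map G (pm Θ z)]; rfl
      rw [RingHom.map_det, RingHom.mapMatrix_apply, h1, hΘ, Tmat, toBlocks_fromBlocks₁₁]
    let Q := q - MvPolynomial.C (z0 c) * D
    have hQ : ∀ z, MvPolynomial.eval (pm Θ z) Q = (Smat z).det * (z c - z0 c) := by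
      intro z
      simp only [Q, map_sub, map_mul, MvPolynomial.eval_C, hq, hD]
      ring
    have hQ0 : ∀ y ∈ W k, MvPolynomial.eval y Q = 0 := by
      intro y hy
      apply hy
      rintro _ ⟨z, rfl⟩
      rw [hΘk, hQ]
      simp [tr, hc]
    have hQ1 : ∀ z, (Smat (tr (k+1) z)).det * (tr (k+1) z c - z0 c) = 0 := by
      intro z
      rw [← hQ, ← hΘk]
      exact hQ0 _ (hge (subset_zcl _ ⟨z, rfl⟩))
    -- polynomial in z
    let p1 : MvPolynomial (Kap d r) ℂ := (Smat (B (k+1))).det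
    let p2 : MvPolynomial (Kap d r) ℂ := B (k+1) c - MvPolynomial.C (z0 c)
    have hp1 : ∀ z, MvPolynomial.eval z p1 = (Smat (tr (k+1) z)).det := by
      intro z
      simp only [p1]
      rw [RingHom.map_det, RingHom.mapMatrix_apply, ← hB]
      rfl
    have hp2 : ∀ z, MvPolynomial.eval z p2 = tr (k+1) z c - z0 c := by
      intro z
      simp only [p2, map_sub, MvPolynomial.eval_C]
      rw [← hB]; rfl
    have hp : p1 * p2 = 0 := by
      apply MvPolynomial.funext
      intro z
      rw [map_mul, hp1, hp2, hQ1, map_zero]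
    rcases mul_eq_zero.1 hp with h | h
    · have := hp1 z0
      rw [h, htr0, hz1] at this
      simp at this
    · have := hp2 (fun c => z0 c + 1)
      rw [h] at this
      simp [tr, hc] at this
  let s : LTSeries {W : Set (ι → ℂ) // IsIrrVariety W ∧ W ⊆ RV d G ∧ w0 ∈ W} :=
    { length := Fintype.card (Kap d r)
      toFun := fun i => ⟨W i, hirr i, hsub i, hmem i⟩
      step := fun i => hlt i i.2 }
  exact Order.LTSeries.length_le_krullDim s

lemma hasDerivAt_eval {ι : Type*} [Fintype ι] [DecidableEq ι] (f : MvPolynomial ι ℂ) (γ : ℂ → ι → ℂ) (v : ι → ℂ)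
    (h : ∀ i, HasDerivAt (fun t => γ t i) (v i) 0) :
    HasDerivAt (fun t => MvPolynomial.eval (γ t) f)
      (∑ i, v i * MvPolynomial.eval (γ 0) (MvPolynomial.pderiv i f)) 0 := by
  induction f using MvPolynomial.induction_on with
  | C a => simpa using hasDerivAt_const (0 : ℂ) a
  | add p q hp hq =>
    simp only [map_add, mul_add, Finset.sum_add_distrib]
    exact hp.add hq
  | mul_X p i hp =>
    have := hp.mul (h i)
    have he : (fun t => MvPolynomial.eval (γ t) (p * MvPolynomial.X i)) =
        (fun t => MvPolynomial.eval (γ t) p) * (fun t => γ t i) := by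
      funext t; simp
    rw [he]
    refine this.congr_deriv ?_
    symm
    simp only [MvPolynomial.pderiv_mul, map_add, map_mul, MvPolynomial.eval_X, mul_add,
      Finset.sum_add_distrib, MvPolynomial.pderiv_X]
    congr 1
    · rw [Finset.sum_mul]; exact Finset.sum_congr rfl fun _ _ => by ring
    · rw [Finset.sum_eq_single i]
      · simp [mul_comm]
      · intro b _ hb
        simp [Pi.single_apply, hb.symm]
      · simp

lemma hasDerivAt_quad {ι : Type*} [Fintype ι] [DecidableEq ι] (f : MvPolynomial ι ℂ) (x v u : ι → ℂ) :
    HasDerivAt (fun t : ℂ => MvPolynomial.eval (x + t • v + t ^ 2 • u) f)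
      (∑ i, v i * MvPolynomial.eval x (MvPolynomial.pderiv i f)) 0 := by
  have := hasDerivAt_eval f (fun t : ℂ => x + t • v + t ^ 2 • u) v (by
    intro i
    have h1 : HasDerivAt (fun t : ℂ => x i + t * v i + t ^ 2 * u i)
      (0 + 1 * v i + (2 * 0 ^ (2 - 1) * 1) * u i) 0 :=
      ((hasDerivAt_const _ _).add ((hasDerivAt_id (0:ℂ)).mul_const _)).add
        (((hasDerivAt_id (0:ℂ)).pow 2).mul_const _)
    simpa using h1)
  simpa using this

lemma mem_zTangent {ι : Type*} [Fintype ι] [DecidableEq ι] (V : Set (ι → ℂ)) (x v u : ι → ℂ)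
    (h : ∀ t : ℂ, x + t • v + t ^ 2 • u ∈ V) : v ∈ zTangent V x := by
  intro f hf
  refine (hasDerivAt_quad f x v u).unique ?_
  have : (fun t : ℂ => MvPolynomial.eval (x + t • v + t ^ 2 • u) f) = fun _ => 0 := by
    funext t; exact hf _ (h t)
  rw [this]
  exact hasDerivAt_const _ _

lemma mrank_add_le {α : Type*} [Fintype α] (A B : Matrix α α ℂ) :
    (A + B).rank ≤ A.rank + B.rank := by
  classical
  unfold Matrix.rank
  rw [Matrix.mulVecLin_add]
  exact (Submodule.finrank_mono (LinearMap.range_add_le _ _)).trans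
    (Submodule.finrank_add_le_finrank_add_finrank _ _)

lemma zTangent_top {ι : Type*} [Fintype ι] [DecidableEq ι] {α : Type*} [Fintype α] [DecidableEq α] {d : ℕ}
    {G : (ι → ℂ) →ₗ[ℂ] Matrix α α ℂ} (hG : Good G)
    (x : ι → ℂ) (hx : (G x).rank < d) : zTangent (RV d G) x = ⊤ := by
  rw [eq_top_iff]
  intro v _
  obtain ⟨g, w, -, hgw⟩ := exists_diag (G v) (hG.symm v)
  have hs : ∀ a, (vecMulVec (fun b => g b a) (fun b => g b a)).IsSymm := by
    intro a; ext i j; simp [vecMulVec_apply, mul_comm]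
  choose u hu using fun a => hG.surj _ (hs a)
  have hv : v = ∑ a, w a • u a := by
    apply hG.inj
    rw [map_sum, hgw]
    ext i j
    rw [Matrix.mul_apply, Matrix.sum_apply]
    simp only [map_smul, hu, mul_diagonal, Matrix.smul_apply, vecMulVec_apply,
      transpose_apply, smul_eq_mul]
    exact Finset.sum_congr rfl fun _ _ => by ring
  rw [hv]
  refine Submodule.sum_mem _ fun a _ => Submodule.smul_mem _ _ ?_
  apply mem_zTangent _ _ _ 0
  intro t
  change (G _).rank ≤ d
  simp only [smul_zero, add_zero, map_add, map_smul, hu]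
  have h2 : (t • vecMulVec (fun b => g b a) (fun b => g b a)).rank ≤ 1 := by
    rw [← smul_vecMulVec]; exact rank_vecMulVec_le _ _
  have := mrank_add_le (G x) (t • vecMulVec (fun b => g b a) (fun b => g b a))
  omega

noncomputable def Lam {ι : Type*} {d r : ℕ}
    (G : (ι → ℂ) →ₗ[ℂ] Matrix (Fin d ⊕ Fin r) (Fin d ⊕ Fin r) ℂ) : (ι → ℂ) →ₗ[ℂ] (Kap d r → ℂ) where
  toFun v := Sum.elim (fun s => G v (Sum.inl s.out.1) (Sum.inl s.out.2))
    (fun ab => G v (Sum.inr ab.1) (Sum.inl ab.2))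
  map_add' v w := by ext (_ | _) <;> simp
  map_smul' v w := by ext (_ | _) <;> simp

lemma Lam_inl {ι : Type*} {d r : ℕ}
    {G : (ι → ℂ) →ₗ[ℂ] Matrix (Fin d ⊕ Fin r) (Fin d ⊕ Fin r) ℂ} (hG : Good G) (v : ι → ℂ) (i j : Fin d) :
    Lam G v (Sum.inl s(i, j)) = G v (Sum.inl i) (Sum.inl j) := by
  simp only [Lam, LinearMap.coe_mk, AddHom.coe_mk, Sum.elim_inl]
  have h : s((s(i,j)).out.1, (s(i,j)).out.2) = s(i,j) := Quot.out_eq s(i, j)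
  rcases Sym2.eq_iff.1 h with ⟨h1, h2⟩ | ⟨h1, h2⟩
  · rw [h1, h2]
  · rw [h1, h2, (hG.symm v).apply]

lemma finrank_zTangent {ι : Type*} [Fintype ι] [DecidableEq ι] {d r : ℕ}
    {G : (ι → ℂ) →ₗ[ℂ] Matrix (Fin d ⊕ Fin r) (Fin d ⊕ Fin r) ℂ} (hG : Good G)
    (w0 : ι → ℂ) (hw0 : G w0 = fromBlocks 1 0 0 0) :
    Module.finrank ℂ (zTangent (RV d G) w0) = Fintype.card (Kap d r) := by
  have hbij : Function.Bijective ((Lam G).domRestrict (zTangent (RV d G) w0)) := by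
    constructor
    · rw [injective_iff_map_eq_zero]
      rintro ⟨v, hv⟩ h0
      rw [LinearMap.domRestrict_apply] at h0
      simp only at h0
      have h11 : ∀ i j, G v (Sum.inl i) (Sum.inl j) = 0 := fun i j => by
        rw [← Lam_inl hG, h0]; rfl
      have h21 : ∀ a j, G v (Sum.inr a) (Sum.inl j) = 0 := fun a j => by
        have := congrFun h0 (Sum.inr (a, j)); exact this
      have h12 : ∀ a j, G v (Sum.inl j) (Sum.inr a) = 0 := fun a j => by
        rw [(hG.symm v).apply]; exact h21 a j
      have h22 : ∀ a b, G v (Sum.inr a) (Sum.inr b) = 0 := by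
        intro a b
        let ρ : Fin d ⊕ Unit → Fin d ⊕ Fin r := Sum.map id (fun _ => a)
        let σ : Fin d ⊕ Unit → Fin d ⊕ Fin r := Sum.map id (fun _ => b)
        let f := ((GP G).submatrix ρ σ).det
        have hf : ∀ y, MvPolynomial.eval y f = ((G y).submatrix ρ σ).det := by
          intro y
          simp only [f]
          rw [RingHom.map_det, RingHom.mapMatrix_apply, ← submatrix_map, GP_map]
        have h1 := hv f (by
          intro y hy
          rw [hf]
          by_contra hne
          have h1 := rank_of_det_ne_zero hne
          have h2 := rank_submatrix_le (G y) ρ σ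
          have h3 : (G y).rank ≤ d := hy
          simp at h1
          omega)
        have h2 := hasDerivAt_quad f w0 v 0
        rw [h1] at h2
        have h3 : (fun t : ℂ => MvPolynomial.eval (w0 + t • v + t ^ 2 • (0 : ι → ℂ)) f) =
            fun t => t * G v (Sum.inr a) (Sum.inr b) := by
          funext t
          rw [hf]
          have : (G (w0 + t • v + t ^ 2 • (0 : ι → ℂ))).submatrix ρ σ =
              fromBlocks (1 : Matrix (Fin d) (Fin d) ℂ) 0 0
                (Matrix.of fun (_ _ : Unit) => t * G v (Sum.inr a) (Sum.inr b)) := by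
            ext (i | i) (j | j) <;>
            simp [hw0, ρ, σ, h11, h12, h21]
          rw [this, det_fromBlocks_zero₂₁]
          simp
        rw [h3] at h2
        have h4 := (hasDerivAt_id (0:ℂ)).mul_const (G v (Sum.inr a) (Sum.inr b))
        have := h4.unique h2
        simpa using this
      have : v = 0 := by
        apply hG.inj
        rw [map_zero]
        ext (i | i) (j | j) <;> simp [h11, h12, h21, h22]
      simp [this]
    · intro y
      let P : Matrix (Fin d ⊕ Fin r) (Fin d) ℂ := fromRows 1 0
      let Q : Matrix (Fin d ⊕ Fin r) (Fin d) ℂ := fromRows ((1/2 : ℂ) • Smat y) (Ymat y)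
      obtain ⟨u, hu⟩ := hG.surj _ (isSymm_gram Q)
      obtain ⟨v, hv⟩ := hG.surj (P * Qᵀ + Q * Pᵀ) (by
        simp [Matrix.IsSymm, transpose_add, transpose_mul, add_comm])
      have hPP : G w0 = P * Pᵀ := by
        rw [hw0]
        simp only [P, transpose_fromRows, fromRows_mul_fromCols]
        simp
      refine ⟨⟨v, mem_zTangent _ _ _ u ?_⟩, ?_⟩
      · intro t
        change (G _).rank ≤ d
        have : G (w0 + t • v + t ^ 2 • u) = (P + t • Q) * (P + t • Q)ᵀ := by
          simp only [map_add, map_smul, hu, hv, hPP, transpose_add, transpose_smul, Matrix.add_mul,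
            Matrix.mul_add, Matrix.smul_mul, Matrix.mul_smul, smul_add, smul_smul, sq]
          abel
        rw [this]
        exact rank_gram_le _ _
      · rw [LinearMap.domRestrict_apply]
        have hv' : G v = fromBlocks (Smat y) (Ymat y)ᵀ (Ymat y) 0 := by
          rw [hv]
          simp only [P, Q, transpose_fromRows, fromRows_mul_fromCols, fromBlocks_add]
          congr 1
          · simp only [transpose_smul, Smat_symm, transpose_one, Matrix.mul_one, Matrix.one_mul, ← add_smul]
            norm_num
          · simp
          · simp
          · simp
        funext c
        rcases c with s | ⟨a, k⟩
        · induction s with | _ i j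
          rw [Lam_inl hG, hv']
          rfl
        · change G v (Sum.inr a) (Sum.inl k) = _
          rw [hv']
          rfl
  have := (LinearEquiv.ofBijective _ hbij).finrank_eq
  rw [this]
  simp

lemma good_conj {ι : Type*} {α : Type*} [Fintype α] [DecidableEq α]
    {G : (ι → ℂ) →ₗ[ℂ] Matrix α α ℂ} (hG : Good G) (d : ℕ) (g : Matrix α α ℂ) (hg : IsUnit g.det) :
    ∃ G' : (ι → ℂ) →ₗ[ℂ] Matrix α α ℂ, Good G' ∧ RV d G' = RV d G ∧
      ∀ w, G' w = g⁻¹ * G w * (g⁻¹)ᵀ := by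
  let G' : (ι → ℂ) →ₗ[ℂ] Matrix α α ℂ :=
    { toFun := fun w => g⁻¹ * G w * (g⁻¹)ᵀ
      map_add' := fun v w => by rw [map_add, Matrix.mul_add, Matrix.add_mul]
      map_smul' := fun c w => by rw [map_smul, Matrix.mul_smul, Matrix.smul_mul]; rfl }
  have hgi : IsUnit (g⁻¹).det := by
    rw [det_nonsing_inv]; exact hg.ringInverse
  have e1 : gᵀ * (g⁻¹)ᵀ = 1 := by rw [← transpose_mul, nonsing_inv_mul _ hg, transpose_one]
  have e2 : (g⁻¹)ᵀ * gᵀ = 1 := by rw [← transpose_mul, mul_nonsing_inv _ hg, transpose_one]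
  have hinv : ∀ A, g * (g⁻¹ * A * (g⁻¹)ᵀ) * gᵀ = A := by
    intro A
    calc g * (g⁻¹ * A * (g⁻¹)ᵀ) * gᵀ = (g * g⁻¹) * A * ((g⁻¹)ᵀ * gᵀ) := by simp only [Matrix.mul_assoc]
      _ = A := by rw [e2, mul_nonsing_inv _ hg]; simp
  have hinv' : ∀ A, g⁻¹ * (g * A * gᵀ) * (g⁻¹)ᵀ = A := by
    intro A
    calc g⁻¹ * (g * A * gᵀ) * (g⁻¹)ᵀ = (g⁻¹ * g) * A * (gᵀ * (g⁻¹)ᵀ) := by simp only [Matrix.mul_assoc]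
      _ = A := by rw [e1, nonsing_inv_mul _ hg]; simp
  refine ⟨G', ⟨?_, ?_, ?_⟩, ?_, fun w => rfl⟩
  · intro v w h
    apply hG.inj
    rw [← hinv (G v), ← hinv (G w)]
    have h' : g⁻¹ * G v * (g⁻¹)ᵀ = g⁻¹ * G w * (g⁻¹)ᵀ := h
    rw [h']
  · intro w
    change (g⁻¹ * G w * (g⁻¹)ᵀ).IsSymm
    rw [Matrix.IsSymm, transpose_mul, transpose_mul, transpose_transpose, (hG.symm w).eq, Matrix.mul_assoc]
  · intro A hA
    obtain ⟨w, hw⟩ := hG.surj (g * A * gᵀ) (by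
      rw [Matrix.IsSymm, transpose_mul, transpose_mul, transpose_transpose, hA.eq, Matrix.mul_assoc])
    refine ⟨w, ?_⟩
    change g⁻¹ * G w * (g⁻¹)ᵀ = A
    rw [hw, hinv']
  · ext w
    change (g⁻¹ * G w * (g⁻¹)ᵀ).rank ≤ d ↔ (G w).rank ≤ d
    rw [rank_mul_eq_left_of_isUnit_det _ _ (by rwa [det_transpose]),
      rank_mul_eq_right_of_isUnit_det _ _ hgi]

lemma smooth_pt {ι : Type*} [Fintype ι] [DecidableEq ι] {d r : ℕ}
    {G : (ι → ℂ) →ₗ[ℂ] Matrix (Fin d ⊕ Fin r) (Fin d ⊕ Fin r) ℂ} (hG : Good G)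
    (w : ι → ℂ) (P : Matrix (Fin d ⊕ Fin r) (Fin d) ℂ) (hP : P.rank = d) (hw : G w = P * Pᵀ) :
    localDim (RV d G) w = (Fintype.card (Kap d r) : ℕ) ∧
    Module.finrank ℂ (zTangent (RV d G) w) = Fintype.card (Kap d r) := by
  obtain ⟨g, hg, hgP⟩ := exists_extend P hP
  obtain ⟨G', hG', hRV, hG'w⟩ := good_conj hG d g hg
  have h0 : G' w = fromBlocks 1 0 0 0 := by
    rw [hG'w, hw, ← Matrix.mul_assoc, Matrix.mul_assoc, ← transpose_mul, ← hgP,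
      nonsing_inv_mul_cancel_left _ _ hg, transpose_fromRows, fromRows_mul_fromCols]
    simp
  refine ⟨le_antisymm ((localDim_le _ _).trans (varDim_le hG)) ?_, ?_⟩
  · rw [← hRV]; exact le_localDim hG' w h0
  · rw [← hRV]; exact finrank_zTangent hG' w h0

lemma varDim_RV {ι : Type*} [Fintype ι] [DecidableEq ι] {d r : ℕ}
    {G : (ι → ℂ) →ₗ[ℂ] Matrix (Fin d ⊕ Fin r) (Fin d ⊕ Fin r) ℂ} (hG : Good G) :
    varDim (RV d G) = (Fintype.card (Kap d r) : ℕ) := by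
  obtain ⟨w0, h0⟩ := hG.surj (fromBlocks 1 0 0 0) (by simp [Matrix.IsSymm, fromBlocks_transpose])
  exact le_antisymm (varDim_le hG) ((le_localDim hG w0 h0).trans (localDim_le _ _))

end SMV



namespace SMV
open Matrix

def wext {R : Type*} [Zero R] {n : ℕ} (w : Edge n → R) (s : Sym2 (Fin n)) : R :=
  if h : s.IsDiag then 0 else w ⟨s, h⟩

lemma wext_diag {R : Type*} [Zero R] {n : ℕ} (w : Edge n → R) (i : Fin n) : wext w s(i, i) = 0 := by
  simp [wext]

lemma wext_val {R : Type*} [Zero R] {n : ℕ} (w : Edge n → R) (e : Edge n) : wext w e.val = w e := by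
  simp [wext, e.2]

lemma wext_aeval {n : ℕ} (y : Edge n → ℂ) (s : Sym2 (Fin n)) :
    MvPolynomial.aeval y (wext (MvPolynomial.X : Edge n → MvPolynomial (Edge n) ℚ) s) = wext y s := by
  unfold wext
  split_ifs <;> simp

lemma wext_cSqLen {n d : ℕ} (w : Edge n → ℂ) (p : Fin n → Fin d → ℂ)
    (h : ∀ e : Edge n, w e = cSqLen p e.val) (s : Sym2 (Fin n)) : wext w s = cSqLen p s := by
  unfold wext
  split_ifs with hs
  · induction s with | _ i j
    rw [Sym2.mk_isDiag_iff] at hs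
    subst hs
    simp [cSqLen]
  · rw [h]

noncomputable def Gm (m : ℕ) : (Edge (m+1) → ℂ) →ₗ[ℂ] Matrix (Fin m) (Fin m) ℂ where
  toFun w := Matrix.of fun i j =>
    (wext w s(0, i.succ) + wext w s(0, j.succ) - wext w s(i.succ, j.succ)) * (1/2)
  map_add' v w := by
    have : ∀ s, wext (v + w) s = wext v s + wext w s := by
      intro s; unfold wext; split_ifs <;> simp
    ext i j; simp only [this, Matrix.add_apply, Matrix.of_apply]; ring
  map_smul' c w := by
    have : ∀ s, wext (c • w) s = c * wext w s := by
      intro s; unfold wext; split_ifs <;> simp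
    ext i j; simp only [this, Matrix.smul_apply, Matrix.of_apply, smul_eq_mul, RingHom.id_apply]; ring

lemma Gm_apply {m : ℕ} (w : Edge (m+1) → ℂ) (i j : Fin m) : Gm m w i j =
    (wext w s(0, i.succ) + wext w s(0, j.succ) - wext w s(i.succ, j.succ)) * (1/2) := rfl

/-- extension of a matrix by zero in index zero -/
def aext {m : ℕ} (A : Matrix (Fin m) (Fin m) ℂ) (i j : Fin (m+1)) : ℂ :=
  Fin.cases 0 (fun a => Fin.cases 0 (fun b => A a b) j) i

lemma aext_symm {m : ℕ} (A : Matrix (Fin m) (Fin m) ℂ) (hA : A.IsSymm) (i j : Fin (m+1)) :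
    aext A i j = aext A j i := by
  refine Fin.cases ?_ (fun a => ?_) i <;> refine Fin.cases ?_ (fun b => ?_) j <;> simp [aext]
  exact hA.apply b a

lemma good_Gm (m : ℕ) : Good (Gm m) := by
  refine ⟨?_, ?_, ?_⟩
  · intro v w h
    have h' : ∀ i j, Gm m v i j = Gm m w i j := fun i j => by rw [h]
    simp only [Gm_apply] at h'
    have h0 : ∀ i : Fin m, wext v s(0, i.succ) = wext w s(0, i.succ) := by
      intro i
      have := h' i i
      simp only [wext_diag] at this
      linear_combination this
    have hij : ∀ i j : Fin m, wext v s(i.succ, j.succ) = wext w s(i.succ, j.succ) := by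
      intro i j
      linear_combination (-2) * h' i j + h0 i + h0 j
    have hall : ∀ s, wext v s = wext w s := by
      intro s
      induction s with | _ i j
      refine Fin.cases ?_ (fun a => ?_) i <;> refine Fin.cases ?_ (fun b => ?_) j
      · simp [wext_diag]
      · exact h0 b
      · rw [Sym2.eq_swap]; exact h0 a
      · exact hij a b
    funext e
    have := hall e.val
    rwa [wext_val, wext_val] at this
  · intro w
    ext i j
    rw [Matrix.transpose_apply, Gm_apply, Gm_apply, Sym2.eq_swap (a := j.succ)]
    ring
  · intro A hA
    let f : Sym2 (Fin (m+1)) → ℂ := Sym2.lift ⟨fun i j => aext A i i + aext A j j - 2 * aext A i j,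
      fun i j => by beta_reduce; rw [aext_symm A hA i j]; ring⟩
    refine ⟨fun e => f e.val, ?_⟩
    have hw : ∀ s, wext (fun e : Edge (m+1) => f e.val) s = f s := by
      intro s
      unfold wext
      split_ifs with hs
      · induction s with | _ i j
        rw [Sym2.mk_isDiag_iff] at hs
        subst hs
        simp only [f, Sym2.lift_mk]; ring
      · rfl
    ext i j
    rw [Gm_apply, hw, hw, hw]
    simp only [f, Sym2.lift_mk, aext, Fin.cases_zero, Fin.cases_succ]
    ring

/-- edge vectors from the base point -/
def Pm {m d : ℕ} (p : Fin (m+1) → Fin d → ℂ) : Matrix (Fin m) (Fin d) ℂ :=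
  Matrix.of fun i k => p i.succ k - p 0 k

lemma Gm_gram {m d : ℕ} (p : Fin (m+1) → Fin d → ℂ) (w : Edge (m+1) → ℂ)
    (h : ∀ e : Edge (m+1), w e = cSqLen p e.val) : Gm m w = Pm p * (Pm p)ᵀ := by
  ext i j
  rw [Gm_apply, wext_cSqLen w p h, wext_cSqLen w p h, wext_cSqLen w p h, Matrix.mul_apply]
  simp only [cSqLen, Sym2.lift_mk, Pm, Matrix.of_apply, Matrix.transpose_apply]
  rw [← Finset.sum_add_distrib, ← Finset.sum_sub_distrib, Finset.sum_mul]
  exact Finset.sum_congr rfl fun k _ => by ring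

lemma exists_config {m d : ℕ} (w : Edge (m+1) → ℂ) (hw : (Gm m w).rank ≤ d) :
    ∃ p : Fin (m+1) → Fin d → ℂ, ∀ e : Edge (m+1), w e = cSqLen p e.val := by
  obtain ⟨P, hP⟩ := exists_gram (Gm m w) ((good_Gm m).symm w) hw
  let p : Fin (m+1) → Fin d → ℂ := fun i => Fin.cases (fun _ => 0) (fun a => P a) i
  refine ⟨p, ?_⟩
  have h2 := Gm_gram p (fun e => cSqLen p e.val) (fun _ => rfl)
  have h3 : Pm p = P := by ext i k; simp [Pm, p]
  rw [h3, ← hP] at h2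
  have := (good_Gm m).inj h2
  intro e
  rw [← this]

lemma Mvar_eq (d m : ℕ) : Mvar d (m+1) = RV d (Gm m) := by
  ext w
  constructor
  · rintro ⟨p, hp⟩
    change (Gm m w).rank ≤ d
    rw [Gm_gram p w hp]
    exact rank_gram_le _ _
  · intro h
    exact exists_config w h

lemma Pm_rank {m d : ℕ} (p : Fin (m+1) → Fin d → ℂ) :
    (Pm p).rank = Module.finrank ℂ (affineSpan ℂ (Set.range p)).direction := by
  rw [Matrix.rank_eq_finrank_span_row, direction_affineSpan,
    vectorSpan_range_eq_span_range_vsub_right ℂ p 0]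
  have : Submodule.span ℂ (Set.range fun i => p i -ᵥ p 0) = Submodule.span ℂ (Set.range (Pm p).row) := by
    apply le_antisymm
    · rw [Submodule.span_le]
      rintro _ ⟨i, rfl⟩
      refine Fin.cases ?_ (fun a => ?_) i
      · simp
      · apply Submodule.subset_span
        exact ⟨a, rfl⟩
    · apply Submodule.span_mono
      rintro _ ⟨a, rfl⟩
      exact ⟨a.succ, rfl⟩
  rw [this]

noncomputable def Gre {ι : Type*} {α β : Type*} (G : (ι → ℂ) →ₗ[ℂ] Matrix α α ℂ) (e : α ≃ β) :
    (ι → ℂ) →ₗ[ℂ] Matrix β β ℂ := (Matrix.reindexLinearEquiv ℂ ℂ e e).toLinearMap ∘ₗ G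

lemma Gre_apply {ι : Type*} {α β : Type*} (G : (ι → ℂ) →ₗ[ℂ] Matrix α α ℂ) (e : α ≃ β) (w : ι → ℂ) :
    Gre G e w = (G w).submatrix e.symm e.symm := rfl

lemma good_Gre {ι : Type*} {α β : Type*} {G : (ι → ℂ) →ₗ[ℂ] Matrix α α ℂ} (hG : Good G) (e : α ≃ β) :
    Good (Gre G e) := by
  refine ⟨?_, ?_, ?_⟩
  · exact (Matrix.reindexLinearEquiv ℂ ℂ e e).injective.comp hG.inj
  · intro w
    rw [Gre_apply]
    exact (hG.symm w).submatrix _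
  · intro A hA
    obtain ⟨w, hw⟩ := hG.surj (A.submatrix e e) (hA.submatrix _)
    refine ⟨w, ?_⟩
    rw [Gre_apply, hw]
    ext i j
    simp

lemma RV_Gre {ι : Type*} {α β : Type*} [Fintype α] [Fintype β] (G : (ι → ℂ) →ₗ[ℂ] Matrix α α ℂ)
    (e : α ≃ β) (d : ℕ) : RV d (Gre G e) = RV d G := by
  ext w
  change (Gre G e w).rank ≤ d ↔ (G w).rank ≤ d
  rw [Gre_apply, Matrix.rank_submatrix]

lemma exists_phi (d m : ℕ) : ∃ φ : (symSub m) ≃ₗ[ℂ] (Edge (m+1) → ℂ),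
      ⇑φ '' {A : symSub m | (A : Matrix (Fin m) (Fin m) ℂ).rank ≤ d} = Mvar d (m+1) := by
  let L : (Edge (m+1) → ℂ) →ₗ[ℂ] symSub m := (Gm m).codRestrict (symSub m) (good_Gm m).symm
  have hL : Function.Bijective L := by
    constructor
    · intro v w h
      exact (good_Gm m).inj (congrArg Subtype.val h)
    · rintro ⟨A, hA⟩
      obtain ⟨w, hw⟩ := (good_Gm m).surj A hA
      exact ⟨w, Subtype.ext hw⟩
  refine ⟨(LinearEquiv.ofBijective L hL).symm, ?_⟩
  rw [Mvar_eq]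
  ext w
  constructor
  · rintro ⟨A, hA, rfl⟩
    obtain ⟨v, rfl⟩ := (LinearEquiv.ofBijective L hL).surjective A
    rw [LinearEquiv.symm_apply_apply]
    exact hA
  · intro hw
    exact ⟨LinearEquiv.ofBijective L hL w, hw, LinearEquiv.symm_apply_apply _ _⟩

lemma isQVariety_Mvar (d m : ℕ) : IsQVariety (Mvar d (m+1)) := by
  classical
  let X : Edge (m+1) → MvPolynomial (Edge (m+1)) ℚ := MvPolynomial.X
  let GQ : Matrix (Fin m) (Fin m) (MvPolynomial (Edge (m+1)) ℚ) := Matrix.of fun i j =>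
    (wext X s(0, i.succ) + wext X s(0, j.succ) - wext X s(i.succ, j.succ)) * MvPolynomial.C (1/2)
  have hGQ : ∀ y : Edge (m+1) → ℂ, GQ.map (MvPolynomial.aeval y) = Gm m y := by
    intro y
    ext i j
    simp only [Matrix.map_apply, GQ, Matrix.of_apply, Gm_apply, map_mul, map_add, map_sub, X,
      wext_aeval, MvPolynomial.aeval_C]
    norm_num
  refine ⟨Finset.univ.image (fun rc : (Fin (d+1) → Fin m) × (Fin (d+1) → Fin m) =>
    (GQ.submatrix rc.1 rc.2).det), ?_⟩
  rw [Mvar_eq]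
  ext y
  change (Gm m y).rank ≤ d ↔ _
  rw [rank_le_iff]
  have key : ∀ r c : Fin (d+1) → Fin m, MvPolynomial.aeval y (GQ.submatrix r c).det =
      ((Gm m y).submatrix r c).det := by
    intro r c
    rw [AlgHom.map_det, AlgHom.mapMatrix_apply, ← submatrix_map, hGQ]
  simp only [Finset.mem_image, Finset.mem_univ, true_and, Set.mem_setOf_eq]
  constructor
  · rintro h _ ⟨rc, rfl⟩
    rw [key]; exact h _ _
  · intro h r c
    rw [← key]; exact h _ ⟨(r, c), rfl⟩

/-- squared length polynomial -/
noncomputable def QP (n d : ℕ) : Sym2 (Fin n) → MvPolynomial (Fin n × Fin d) ℚ :=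
  Sym2.lift ⟨fun i j => ∑ k, (MvPolynomial.X (i, k) - MvPolynomial.X (j, k)) ^ 2,
    fun i j => Finset.sum_congr rfl fun k _ => by ring⟩

lemma aeval_QP {n d : ℕ} (p : Fin n → Fin d → ℂ) (s : Sym2 (Fin n)) :
    MvPolynomial.aeval (fun ik : Fin n × Fin d => p ik.1 ik.2) (QP n d s) = cSqLen p s := by
  induction s with | _ i j
  simp [QP, cSqLen]

lemma generic_pt {n d : ℕ} (p : Fin n → Fin d → ℂ) (hp : GenericConfigC p) :
    IsGenericPt (Mvar d n) (fun e => cSqLen p e.val) := by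
  refine ⟨⟨p, fun _ => rfl⟩, ?_⟩
  intro f hf y hy
  obtain ⟨q, hq⟩ := hy
  have key : ∀ p : Fin n → Fin d → ℂ, MvPolynomial.aeval (fun ik : Fin n × Fin d => p ik.1 ik.2)
      (MvPolynomial.bind₁ (fun e : Edge n => QP n d e.val) f) =
      MvPolynomial.aeval (fun e : Edge n => cSqLen p e.val) f := by
    intro p
    rw [MvPolynomial.aeval_bind₁]
    simp only [aeval_QP]
  have h0 : MvPolynomial.bind₁ (fun e : Edge n => QP n d e.val) f = 0 := by
    by_contra h
    exact hp _ h (by rw [key, hf])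
  have : y = fun e : Edge n => cSqLen q e.val := funext hq
  rw [this, ← key, h0, map_zero]

lemma generic_ofReal {n d : ℕ} (p : Fin n → Fin d → ℝ) (hp : GenericConfig p) :
    GenericConfigC (fun i k => (p i k : ℂ)) := by
  intro f hf h
  apply hp f hf
  have := MvPolynomial.aeval_algebraMap_apply (R := ℚ) ℂ (fun ik : Fin n × Fin d => p ik.1 ik.2) f
  have h2 : (algebraMap ℝ ℂ) (MvPolynomial.aeval (fun ik : Fin n × Fin d => p ik.1 ik.2) f) = 0 := by
    rw [← this]; exact h
  exact (map_eq_zero _).1 h2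

lemma cSqLen_ofReal {n d : ℕ} (p : Fin n → Fin d → ℝ) (s : Sym2 (Fin n)) :
    ((sqLenR p s : ℝ) : ℂ) = cSqLen (fun i k => (p i k : ℂ)) s := by
  induction s with | _ i j
  simp [sqLenR, cSqLen]

lemma card_kap (d r : ℕ) : Fintype.card (Kap d r) = d * (d + r + 1) - (d+1).choose 2 := by
  have h : Fintype.card (Kap d r) = (d+1).choose 2 + r * d := by
    unfold Kap
    simp [Sym2.card]
  have h2 : (d+1).choose 2 * 2 = (d + 1) * d := by
    have := Nat.choose_two_right (d+1)
    rw [this]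
    exact Nat.div_mul_cancel (by simpa using (Nat.even_mul_pred_self (d+1)).two_dvd)
  rw [h]
  have h3 : d * (d + r + 1) = (d+1) * d + r * d := by ring
  omega

lemma card_edge (n : ℕ) : Fintype.card (Edge n) = n.choose 2 := by
  rw [Sym2.card_subtype_not_diag, Fintype.card_fin]

lemma kap_lt (d r : ℕ) : Fintype.card (Kap d (r+1)) < Fintype.card (Edge (d + (r+1) + 1)) := by
  have h : Fintype.card (Kap d (r+1)) = (d+1).choose 2 + (r+1) * d := by
    unfold Kap
    simp [Sym2.card]
  rw [h, card_edge]
  have h2 : ∀ d, (d+1).choose 2 * 2 = (d + 1) * d := by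
    intro d
    have := Nat.choose_two_right (d+1)
    rw [this]
    exact Nat.div_mul_cancel (by simpa using (Nat.even_mul_pred_self (d+1)).two_dvd)
  have h3 := h2 d
  have h4 := h2 (d + (r+1))
  have : (d + (r+1) + 1) * (d + (r+1)) = (d+1)*d + 2 * ((r+1) * d) + (r+1)*(r+2) := by ring
  have : 0 < (r+1)*(r+2) := by positivity
  omega

lemma main_thm {d r : ℕ} :
    (∃ φ : (symSub (d + (r+1))) ≃ₗ[ℂ] (Edge (d + (r+1) + 1) → ℂ),
      ⇑φ '' {A : symSub (d + (r+1)) | (A : Matrix (Fin (d + (r+1))) (Fin (d + (r+1))) ℂ).rank ≤ d}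
        = Mvar d (d + (r+1) + 1)) ∧
    IsQVariety (Mvar d (d + (r+1) + 1)) ∧
    IsIrrVariety (Mvar d (d + (r+1) + 1)) ∧
    varDim (Mvar d (d + (r+1) + 1)) = ((d * (d + (r+1) + 1) - (d + 1).choose 2 : ℕ) : WithBot ℕ∞) ∧
    {w | IsSingularPt (Mvar d (d + (r+1) + 1)) w} =
      {w | ∃ p : Fin (d + (r+1) + 1) → Fin d → ℂ, (∀ e : Edge (d + (r+1) + 1), w e = cSqLen p e.val) ∧
        Module.finrank ℂ (affineSpan ℂ (Set.range p)).direction < d} ∧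
    (∀ p : Fin (d + (r+1) + 1) → Fin d → ℂ, GenericConfigC p →
      IsGenericPt (Mvar d (d + (r+1) + 1)) (fun e => cSqLen p e.val)) ∧
    (∀ p : Fin (d + (r+1) + 1) → Fin d → ℝ, GenericConfig p →
      IsGenericPt (Mvar d (d + (r+1) + 1)) (fun e => ((sqLenR p e.val : ℝ) : ℂ))) := by
  let σ : Fin (d + (r+1)) ≃ Fin d ⊕ Fin (r+1) := finSumFinEquiv.symm
  have hg := good_Gre (good_Gm (d + (r+1))) σ
  have hM : Mvar d (d + (r+1) + 1) = RV d (Gre (Gm (d + (r+1))) σ) := by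
    rw [Mvar_eq, RV_Gre]
  have hdim : varDim (Mvar d (d + (r+1) + 1)) = ((Fintype.card (Kap d (r+1)) : ℕ) : WithBot ℕ∞) := by
    rw [hM]; exact varDim_RV hg
  refine ⟨exists_phi _ _, isQVariety_Mvar _ _, ?_, ?_, ?_, generic_pt, ?_⟩
  · rw [hM]; exact irr_RV hg d
  · rw [hdim, card_kap]
  · ext w
    constructor
    · rintro ⟨⟨p, hp⟩, hne⟩
      refine ⟨p, hp, ?_⟩
      rw [← Pm_rank]
      by_contra hlt
      have hle : (Pm p).rank ≤ d := by simpa using (Pm p).rank_le_card_width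
      have hr : (Pm p).rank = d := by omega
      have hs := smooth_pt hg w ((Pm p).submatrix σ.symm (Equiv.refl _))
        (by rw [Matrix.rank_submatrix]; exact hr)
        (by
          rw [Gre_apply, Gm_gram p w hp]
          rfl)
      rw [hM] at hne
      apply hne
      rw [hs.1, hs.2]
    · rintro ⟨p, hp, hlt⟩
      refine ⟨⟨p, hp⟩, ?_⟩
      rw [← Pm_rank] at hlt
      have h1 : (Gre (Gm (d + (r+1))) σ w).rank < d := by
        rw [Gre_apply, Matrix.rank_submatrix, Gm_gram p w hp]
        exact (Matrix.rank_mul_le_left _ _).trans_lt hlt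
      have h2 := zTangent_top hg w h1
      rw [← hM] at h2
      rw [h2, finrank_top, Module.finrank_fintype_fun_eq_card]
      intro heq
      have h3 := localDim_le (Mvar d (d + (r+1) + 1)) w
      rw [← heq, hdim] at h3
      have h4 := kap_lt d r
      have h5 : Fintype.card (Edge (d + (r+1) + 1)) ≤ Fintype.card (Kap d (r+1)) := by
        exact_mod_cast h3
      omega
  · intro p hp
    have := generic_pt _ (generic_ofReal p hp)
    simpa only [cSqLen_ofReal] using this

end SMV


/-- For `n ≥ d+2`:  `M_{d,n}` is linearly isomorphic to the
variety of complex symmetric `(n−1)×(n−1)` matrices of rank at most `d`;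
consequently `M_{d,n}` is a variety defined over ℚ, it is irreducible, and its
dimension is `d·n − C(d+1,2)`.  Its singular locus consists exactly of the
squared measurements of complex configurations whose affine span has dimension
strictly less than `d`.  Moreover, the squared measurement vector of a generic
complex configuration in ℂ^d, or of a generic configuration in ℝ^d, is a
generic point of `M_{d,n}`. -/
theorem squared_measurement_variety_structure
    {d n : ℕ} (hd : 1 ≤ d) (hn : d + 2 ≤ n) :
    (∃ φ : (symSub (n - 1)) ≃ₗ[ℂ] (Edge n → ℂ),
      ⇑φ '' {A : symSub (n - 1) | (A : Matrix (Fin (n - 1)) (Fin (n - 1)) ℂ).rank ≤ d}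
        = Mvar d n) ∧
    IsQVariety (Mvar d n) ∧
    IsIrrVariety (Mvar d n) ∧
    varDim (Mvar d n) = ((d * n - (d + 1).choose 2 : ℕ) : WithBot ℕ∞) ∧
    {w | IsSingularPt (Mvar d n) w} =
      {w | ∃ p : Fin n → Fin d → ℂ, (∀ e : Edge n, w e = cSqLen p e.val) ∧
        Module.finrank ℂ (affineSpan ℂ (Set.range p)).direction < d} ∧
    (∀ p : Fin n → Fin d → ℂ, GenericConfigC p →
      IsGenericPt (Mvar d n) (fun e => cSqLen p e.val)) ∧
    (∀ p : Fin n → Fin d → ℝ, GenericConfig p →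
      IsGenericPt (Mvar d n) (fun e => ((sqLenR p e.val : ℝ) : ℂ))) := by
  obtain ⟨r, rfl⟩ := Nat.exists_eq_add_of_le hn
  have e : d + 2 + r = d + (r + 1) + 1 := by omega
  rw [e]
  exact SMV.main_thm
end

section
/- Let n ≥ d+2 and set N = C(n,2) and C = C(d+1,2). Then L_{d,n} is an algebraic variety of pure dimension dn − C. If moreover d ≥ 2, then: L_{d,n} is irreducible; if m is a generic point of M_{d,n}, then every point of s^{-1}(m) is a generic point of L_{d,n}; and if p is a generic configuration in ℝ^d, then l(p) is a generic point of L_{d,n}. -/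
/-- Euclidean length along an edge of a real configuration. -/
noncomputable def lenR {n d : ℕ} (p : Fin n → Fin d → ℝ) : Sym2 (Fin n) → ℝ :=
  Sym2.lift ⟨fun i j => Real.sqrt (∑ k, (p i k - p j k) ^ 2),
    fun i j => congrArg Real.sqrt (Finset.sum_congr rfl fun k _ => by ring)⟩

/-- `W` is an irreducible component of `V`: a maximal irreducible subvariety. -/
def IsComponent {ι : Type*} (V W : Set (ι → ℂ)) : Prop :=
  IsIrrVariety W ∧ W ⊆ V ∧
    ∀ W' : Set (ι → ℂ), IsIrrVariety W' → W ⊆ W' → W' ⊆ V → W' = W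


theorem dim_integral {R S : Type*} [CommRing R] [CommRing S] [Algebra R S]
    [Algebra.IsIntegral R S] (hinj : Function.Injective (algebraMap R S)) :
    ringKrullDim S = ringKrullDim R := by
  apply le_antisymm
  · refine Order.krullDim_le_of_strictMono (PrimeSpectrum.comap (algebraMap R S)) ?_
    intro P Q h
    exact Ideal.IsIntegral.comap_lt_comap (R := R) (I := P.asIdeal) (J := Q.asIdeal) h
  · have : Algebra.HasGoingUp R S := ⟨fun {q} _ P _ h => by
      obtain ⟨Q, h1, h2, h3⟩ := Ideal.exists_ideal_over_prime_of_isIntegral q P h.le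
      exact ⟨Q, h1, h2, ⟨h3.symm⟩⟩⟩
    refine iSup_le fun l => ?_
    obtain ⟨P, -, hP, h3⟩ := Ideal.exists_ideal_over_prime_of_isIntegral (S := S)
      (RelSeries.head l).asIdeal ⊥ (by
        have : RingHom.ker (algebraMap R S) = ⊥ := (RingHom.injective_iff_ker_eq_bot _).1 hinj
        change RingHom.ker (algebraMap R S) ≤ _
        rw [this]; exact bot_le)
    have : P.LiesOver (RelSeries.head l).asIdeal := ⟨h3.symm⟩
    obtain ⟨L, hL, -⟩ := Ideal.exists_ltSeries_of_hasGoingUp l P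
    rw [← hL]
    exact Order.LTSeries.length_le_krullDim L

theorem dim_of_trdeg {k A : Type} [Field k] [CommRing A] [IsDomain A] [Algebra k A]
    [Algebra.FiniteType k A] (D : ℕ) (h : Algebra.trdeg k A = D) : ringKrullDim A = D := by
  obtain ⟨s, g, hg, hi⟩ := exists_integral_inj_algHom_of_fg k A
  let : Algebra (MvPolynomial (Fin s) k) A := g.toRingHom.toAlgebra
  have : Algebra.IsIntegral (MvPolynomial (Fin s) k) A := ⟨hi⟩
  have : IsScalarTower k (MvPolynomial (Fin s) k) A :=
    IsScalarTower.of_algebraMap_eq (fun x => (g.commutes x).symm)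
  have hinj : Function.Injective (algebraMap (MvPolynomial (Fin s) k) A) := hg
  rw [dim_integral hinj, MvPolynomial.ringKrullDim_of_isNoetherianRing,
    ringKrullDim_eq_zero_of_field]
  have : FaithfulSMul (MvPolynomial (Fin s) k) A :=
    (faithfulSMul_iff_algebraMap_injective _ _).2 hinj
  have := trdeg_add_eq k (MvPolynomial (Fin s) k) (A := A)
  rw [h, trdeg_eq_zero (R := MvPolynomial (Fin s) k) (A := A), MvPolynomial.trdeg_of_isDomain] at this
  simp at this
  have : s = D := by exact_mod_cast this
  simp [this]

theorem trdeg_of {k T : Type} [Field k] [CommRing T] [IsDomain T] [Algebra k T] {ι κ : Type}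
    [Fintype κ] (y : ι → T) (hy : Algebra.adjoin k (Set.range y) = ⊤) (G : κ → T)
    (hG : AlgebraicIndependent k G)
    (ha : ∀ i, IsAlgebraic (Algebra.adjoin k (Set.range G)) (y i)) :
    Algebra.trdeg k T = (Fintype.card κ : ℕ) := by
  have hal : Algebra.IsAlgebraic (Algebra.adjoin k (Set.range G)) T := by
    have : Algebra.adjoin k (Set.range y) ≤
        (Subalgebra.algebraicClosure (Algebra.adjoin k (Set.range G)) T).restrictScalars k := by
      rw [Algebra.adjoin_le_iff]
      rintro _ ⟨i, rfl⟩
      exact ha i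
    rw [hy] at this
    exact ⟨fun x => this (Algebra.mem_top : x ∈ _)⟩
  have hb : IsTranscendenceBasis k G := by
    exact hG.isTranscendenceBasis_iff_isAlgebraic.2 hal
  rw [← hb.cardinalMk_eq_trdeg]
  simp

section corr
open MvPolynomial
variable {ι : Type} [Finite ι]

theorem isVariety_zeroLocus (I : Ideal (MvPolynomial ι ℂ)) : IsVariety (zeroLocus ℂ I) := by
  obtain ⟨S, hS⟩ := (isNoetherianRing_iff_ideal_fg _).1 inferInstance I
  refine ⟨S, ?_⟩
  rw [← hS, zeroLocus_span]
  simp [aeval_eq_eval]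

theorem IsVariety.zl {V : Set (ι → ℂ)} (h : IsVariety V) :
    zeroLocus ℂ (vanishingIdeal ℂ V) = V := by
  obtain ⟨S, rfl⟩ := h
  apply le_antisymm _ (zeroLocus_vanishingIdeal_le _)
  intro x hx f hf
  have := hx f (by
    intro y hy
    simpa [aeval_eq_eval] using hy f hf)
  simpa [aeval_eq_eval] using this

theorem irr_iff {V : Set (ι → ℂ)} :
    IsIrrVariety V ↔ IsVariety V ∧ (vanishingIdeal ℂ V).IsPrime := by
  constructor
  · rintro ⟨h1, ⟨x, hx⟩, h3⟩
    refine ⟨h1, ⟨?_, ?_⟩⟩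
    · intro h
      have : (1 : MvPolynomial ι ℂ) ∈ vanishingIdeal ℂ V := h ▸ Submodule.mem_top
      simpa using this x hx
    · intro f g hfg
      have key : ∀ f : MvPolynomial ι ℂ,
          V = zeroLocus ℂ (vanishingIdeal ℂ V ⊔ Ideal.span {f}) → f ∈ vanishingIdeal ℂ V := by
        intro f h x hx
        rw [h] at hx
        exact hx f (Ideal.mem_sup_right (Ideal.mem_span_singleton_self f))
      have hV : V = zeroLocus ℂ (vanishingIdeal ℂ V ⊔ Ideal.span {f}) ∪
          zeroLocus ℂ (vanishingIdeal ℂ V ⊔ Ideal.span {g}) := by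
        apply le_antisymm
        · intro x hx
          have h := hfg x hx
          rw [map_mul, mul_eq_zero] at h
          have : ∀ f : MvPolynomial ι ℂ, aeval x f = 0 →
              x ∈ zeroLocus ℂ (vanishingIdeal ℂ V ⊔ Ideal.span {f}) := by
            intro f hf
            have : vanishingIdeal ℂ V ⊔ Ideal.span {f} ≤ vanishingIdeal ℂ {x} := by
              refine sup_le (vanishingIdeal_anti_mono (by simpa using hx)) ?_
              rw [Ideal.span_singleton_le_iff_mem, mem_vanishingIdeal_singleton_iff]
              exact hf
            exact le_zeroLocus_iff_le_vanishingIdeal.2 this rfl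
          exact h.imp (this f) (this g)
        · apply Set.union_subset <;>
          · refine (zeroLocus_anti_mono le_sup_left).trans ?_
            rw [h1.zl]
      exact (h3 _ _ (isVariety_zeroLocus _) (isVariety_zeroLocus _) hV).imp (key f) (key g)
  · rintro ⟨h1, h2⟩
    refine ⟨h1, ?_, ?_⟩
    · rw [Set.nonempty_iff_ne_empty]
      rintro rfl
      exact h2.ne_top vanishingIdeal_empty
    · intro V₁ V₂ hV₁ hV₂ h
      have : vanishingIdeal ℂ V₁ * vanishingIdeal ℂ V₂ ≤ vanishingIdeal ℂ V := by
        rw [Ideal.mul_le]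
        intro f hf g hg x hx
        rw [h] at hx
        rw [map_mul]
        rcases hx with hx | hx
        · rw [hf x hx, zero_mul]
        · rw [hg x hx, mul_zero]
      rcases (Ideal.IsPrime.mul_le h2).1 this with h' | h'
      · left
        apply le_antisymm
        · rw [← hV₁.zl]; exact le_zeroLocus_iff_le_vanishingIdeal.2 h'
        · rw [h]; exact Set.subset_union_left
      · right
        apply le_antisymm
        · rw [← hV₂.zl]; exact le_zeroLocus_iff_le_vanishingIdeal.2 h'
        · rw [h]; exact Set.subset_union_right

theorem irr_zeroLocus (P : Ideal (MvPolynomial ι ℂ)) [P.IsPrime] :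
    IsIrrVariety (zeroLocus ℂ P) := by
  rw [irr_iff]
  refine ⟨isVariety_zeroLocus P, ?_⟩
  rw [IsPrime.vanishingIdeal_zeroLocus]; infer_instance

theorem varDim_zeroLocus (P : Ideal (MvPolynomial ι ℂ)) :
    varDim (zeroLocus ℂ P) = ringKrullDim (MvPolynomial ι ℂ ⧸ P) := by
  rw [ringKrullDim_quotient, varDim, ← Order.krullDim_orderDual]
  refine Order.krullDim_eq_of_orderIso ?_
  refine OrderIso.symm (α := PrimeSpectrum.zeroLocus (P : Set (MvPolynomial ι ℂ))) ?_
  refine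
    { toFun := fun Q => OrderDual.toDual ⟨zeroLocus ℂ Q.1.asIdeal, irr_zeroLocus _,
        zeroLocus_anti_mono Q.2⟩
      invFun := fun W => ⟨⟨vanishingIdeal ℂ (OrderDual.ofDual W).1,
        (irr_iff.1 (OrderDual.ofDual W).2.1).2⟩,
        le_zeroLocus_iff_le_vanishingIdeal.1 (OrderDual.ofDual W).2.2⟩
      left_inv := ?_
      right_inv := ?_
      map_rel_iff' := ?_ }
  · intro Q
    ext1; ext1
    exact IsPrime.vanishingIdeal_zeroLocus _
  · intro W
    apply OrderDual.ofDual.injective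
    ext1
    exact (OrderDual.ofDual W).2.1.1.zl
  · intro Q Q'
    change zeroLocus ℂ Q'.1.asIdeal ≤ zeroLocus ℂ Q.1.asIdeal ↔ Q.1.asIdeal ≤ Q'.1.asIdeal
    rw [le_zeroLocus_iff_le_vanishingIdeal, IsPrime.vanishingIdeal_zeroLocus]

end corr


section decomp
open MvPolynomial
variable {ι : Type} [Fintype ι] [DecidableEq ι]

theorem exists_decomp {k : Type} [CommRing k] (f : MvPolynomial ι k) :
    ∃ h : Finset ι → MvPolynomial ι k, f = ∑ S, (∏ e ∈ S, X e) * expand 2 (h S) := by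
  induction f using MvPolynomial.induction_on' with
  | monomial s a =>
    refine ⟨Pi.single (Finset.univ.filter fun e => s e % 2 = 1)
      (monomial (Finsupp.equivFunOnFinite.symm fun e => s e / 2) a), ?_⟩
    rw [Finset.sum_eq_single (Finset.univ.filter fun e => s e % 2 = 1)]
    · rw [Pi.single_eq_same, monomial_eq, monomial_eq, map_mul, expand_C, mul_left_comm]
      congr 1
      rw [Finsupp.prod_fintype _ _ (by simp), Finsupp.prod_fintype _ _ (by simp),
        map_prod, Finset.prod_filter, ← Finset.prod_mul_distrib]
      refine Finset.prod_congr rfl fun e _ => ?_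
      simp only [Finsupp.equivFunOnFinite_symm_apply_apply, map_pow, expand_X, ← pow_mul]
      split_ifs with h
      · rw [← pow_succ']; congr 1; omega
      · rw [one_mul]; congr 1; omega
    · intro S _ hS
      rw [Pi.single_eq_of_ne hS]; simp
    · simp
  | add p q hp hq =>
    obtain ⟨h1, h1'⟩ := hp
    obtain ⟨h2, h2'⟩ := hq
    refine ⟨h1 + h2, ?_⟩
    simp only [Pi.add_apply, map_add, mul_add, Finset.sum_add_distrib]
    rw [← h1', ← h2']

theorem aeval_expand_two {k F : Type} [CommRing k] [CommRing F] [Algebra k F] (x : ι → F)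
    (h : MvPolynomial ι k) : aeval x (expand 2 h) = aeval (fun e => x e ^ 2) h := by
  have : (aeval x).comp (expand 2) = aeval (R := k) (fun e => x e ^ 2) := by
    ext e; simp
  rw [← this]; rfl

theorem aeval_decomp {k F : Type} [CommRing k] [CommRing F] [Algebra k F] (x : ι → F)
    {f : MvPolynomial ι k} {h : Finset ι → MvPolynomial ι k}
    (hf : f = ∑ S, (∏ e ∈ S, X e) * expand 2 (h S)) :
    aeval x f = ∑ S, (∏ e ∈ S, x e) * aeval (fun e => x e ^ 2) (h S) := by
  rw [hf, map_sum]
  refine Finset.sum_congr rfl fun S _ => ?_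
  rw [map_mul, map_prod, aeval_expand_two]
  simp

theorem ded {Γ F J : Type} [Monoid Γ] [Field F] [Fintype J] (χ : J → Γ →* F)
    (hχ : Function.Injective χ) (a : J → F) (h : ∀ γ, ∑ j, a j * χ j γ = 0) (j : J) : a j = 0 := by
  have := (linearIndependent_monoidHom Γ F).comp χ hχ
  rw [Fintype.linearIndependent_iff] at this
  refine this a ?_ j
  ext γ
  simpa using h γ

def sgChar (F : Type) [Field F] (e : ι) : (ι → ℤˣ) →* F :=
  (((Int.castRingHom F : ℤ →* F).comp (Units.coeHom ℤ)).comp (Pi.evalMonoidHom _ e))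

theorem sgChar_apply (F : Type) [Field F] (e : ι) (g : ι → ℤˣ) :
    sgChar F e g = (((g e : ℤˣ) : ℤ) : F) := rfl

theorem sgChar_inj (F : Type) [Field F] [CharZero F] :
    Function.Injective fun S : Finset ι => ∏ e ∈ S, sgChar F e := by
  have key : ∀ (S : Finset ι) (e : ι), (∏ e ∈ S, sgChar F e) (Function.update (1 : ι → ℤˣ) e (-1)) =
      if e ∈ S then -1 else 1 := by
    intro S e
    rw [MonoidHom.finsetProd_apply]
    simp only [sgChar_apply, Function.update_apply]
    simp only [Pi.one_apply, apply_ite (fun u : ℤˣ => (((u : ℤˣ) : ℤ) : F))]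
    simp only [Units.val_one, Int.cast_one, Units.val_neg, Int.cast_neg]
    rw [Finset.prod_ite_eq']
  intro S T h
  ext e
  have h1 := DFunLike.congr_fun h (Function.update (1 : ι → ℤˣ) e (-1))
  simp only [key] at h1
  have h2 : (-1 : F) ≠ 1 := by norm_num
  by_cases hS : e ∈ S <;> by_cases hT : e ∈ T <;> simp [hS, hT] at h1 ⊢
  · exact h2 h1
  · exact h2 h1.symm

theorem signs {k F : Type} [CommRing k] [Field F] [CharZero F] [Algebra k F] (x : ι → F)
    {f : MvPolynomial ι k} {h : Finset ι → MvPolynomial ι k}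
    (hf : f = ∑ S, (∏ e ∈ S, X e) * expand 2 (h S))
    (hg : ∀ g : ι → ℤˣ, aeval (fun e => (((g e : ℤˣ) : ℤ) : F) * x e) f = 0) (S : Finset ι) :
    (∏ e ∈ S, x e) * aeval (fun e => x e ^ 2) (h S) = 0 := by
  refine ded (fun S : Finset ι => ∏ e ∈ S, sgChar F e) (sgChar_inj F)
    (fun S => (∏ e ∈ S, x e) * aeval (fun e => x e ^ 2) (h S)) ?_ S
  intro g
  rw [← hg g, aeval_decomp _ hf]
  refine Finset.sum_congr rfl fun S _ => ?_
  have : (fun e => ((((g e : ℤˣ) : ℤ) : F) * x e) ^ 2) = fun e => x e ^ 2 := by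
    ext e
    rcases Int.units_eq_one_or (g e) with h | h <;> simp [h]
  rw [this, Finset.prod_mul_distrib, MonoidHom.finsetProd_apply]
  simp only [sgChar_apply]
  ring

theorem kummer {K F : Type} [Field K] [Field F] [Algebra K F] [CharZero K] [IsGalois K F]
    (y : ι → F) (a : ι → K) (hy : ∀ e, y e ^ 2 = algebraMap K F (a e)) (ha : ∀ e, a e ≠ 0)
    (hns : ∀ S : Finset ι, S.Nonempty → ¬ IsSquare (∏ e ∈ S, a e))
    (c : Finset ι → K) (hc : ∑ S, (∏ e ∈ S, y e) * algebraMap K F (c S) = 0) (S : Finset ι) :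
    c S = 0 := by
  have hy0 : ∀ e, y e ≠ 0 := by
    intro e h
    have := hy e
    rw [h] at this
    rw [zero_pow two_ne_zero] at this
    exact ha e ((map_eq_zero _).1 this.symm)
  have hs : ∀ (σ : F ≃ₐ[K] F) e, (σ (y e) / y e) ^ 2 = 1 := by
    intro σ e
    rw [div_pow, ← map_pow, hy, AlgEquiv.commutes, div_self]
    simpa using ha e
  let χ : ι → (F ≃ₐ[K] F) →* F := fun e =>
    { toFun := fun σ => σ (y e) / y e
      map_one' := by simp [hy0 e]
      map_mul' := by
        intro σ τ
        have h1 : σ (τ (y e) / y e) = τ (y e) / y e := by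
          rcases mul_self_eq_one_iff.1 ((sq _).symm.trans (hs τ e)) with h | h <;> simp [h]
        rw [AlgEquiv.mul_apply]
        have h2 : τ (y e) = (τ (y e) / y e) * y e := by rw [div_mul_cancel₀ _ (hy0 e)]
        conv_lhs => rw [h2, map_mul, h1]
        ring }
  have hχ : ∀ e σ, σ (y e) = χ e σ * y e := by
    intro e σ
    change σ (y e) = σ (y e) / y e * y e
    rw [div_mul_cancel₀ _ (hy0 e)]
  have hχp : ∀ (S : Finset ι) σ, σ (∏ e ∈ S, y e) = (∏ e ∈ S, χ e) σ * ∏ e ∈ S, y e := by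
    intro S σ
    rw [map_prod, MonoidHom.finsetProd_apply, ← Finset.prod_mul_distrib]
    exact Finset.prod_congr rfl fun e _ => hχ e σ
  have hχ2 : ∀ (S : Finset ι) σ, (∏ e ∈ S, χ e) σ * (∏ e ∈ S, χ e) σ = 1 := by
    intro S σ
    rw [MonoidHom.finsetProd_apply, ← Finset.prod_mul_distrib]
    exact Finset.prod_eq_one fun e _ => by rw [← sq]; exact hs σ e
  have hinj : Function.Injective fun S : Finset ι => ∏ e ∈ S, χ e := by
    intro S T h
    by_contra hne
    have hz : ∀ σ : F ≃ₐ[K] F, σ ((∏ e ∈ S, y e) * ∏ e ∈ T, y e) =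
        (∏ e ∈ S, y e) * ∏ e ∈ T, y e := by
      intro σ
      have h' : (∏ e ∈ S, χ e) = ∏ e ∈ T, χ e := h
      rw [map_mul, hχp, hχp, ← h', mul_mul_mul_comm, hχ2, one_mul]
    obtain ⟨b, hb⟩ := (InfiniteGalois.mem_range_algebraMap_iff_fixed _).2 hz
    have hb2 : b ^ 2 = (∏ e ∈ S, a e) * ∏ e ∈ T, a e := by
      apply (algebraMap K F).injective
      rw [map_pow, hb, map_mul, map_prod, map_prod, mul_pow, ← Finset.prod_pow,
        ← Finset.prod_pow]
      simp only [hy]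
    have hU : (symmDiff S T).Nonempty := by
      rw [Finset.nonempty_iff_ne_empty]
      intro h
      exact hne (symmDiff_eq_bot.1 h)
    apply hns _ hU
    have hi : ∏ e ∈ S ∩ T, a e ≠ 0 := Finset.prod_ne_zero_iff.2 fun e _ => ha e
    refine ⟨b / ∏ e ∈ S ∩ T, a e, ?_⟩
    rw [div_mul_div_comm, eq_div_iff (mul_ne_zero hi hi), ← sq b, hb2]
    have h1 : symmDiff S T = (S \ T) ∪ (T \ S) := rfl
    have h2 : Disjoint (S \ T) (T \ S) := disjoint_sdiff_sdiff
    rw [h1, Finset.prod_union h2, ← Finset.prod_inter_mul_prod_sdiff S T a,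
      ← Finset.prod_inter_mul_prod_sdiff T S a, Finset.inter_comm T S]
    ring
  have := ded (fun S : Finset ι => ∏ e ∈ S, χ e) hinj
    (fun S => (∏ e ∈ S, y e) * algebraMap K F (c S)) (by
      intro σ
      have := congrArg σ hc
      rw [map_sum, map_zero] at this
      rw [← this]
      refine Finset.sum_congr rfl fun S _ => ?_
      rw [map_mul, hχp, AlgEquiv.commutes]
      ring) S
  have h0 : ∏ e ∈ S, y e ≠ 0 := Finset.prod_ne_zero_iff.2 fun e _ => hy0 e
  simpa [h0] using this

end decomp


section gramsec
open MvPolynomial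

def extE {n : ℕ} {R : Type} [Zero R] (x : Edge n → R) (i j : Fin n) : R :=
  if h : i = j then 0 else x ⟨s(i, j), by simpa using h⟩

theorem extE_self {n : ℕ} {R : Type} [Zero R] (x : Edge n → R) (i : Fin n) : extE x i i = 0 := by
  simp [extE]

theorem extE_comm {n : ℕ} {R : Type} [Zero R] (x : Edge n → R) (i j : Fin n) :
    extE x i j = extE x j i := by
  unfold extE
  by_cases h : i = j
  · simp [h]
  · rw [dif_neg h, dif_neg (Ne.symm h)]
    congr 2
    exact Sym2.eq_swap

theorem extE_ne {n : ℕ} {R : Type} [Zero R] (x : Edge n → R) (i j : Fin n)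
    (h : ¬ (s(i, j) : Sym2 (Fin n)).IsDiag) :
    extE x i j = x ⟨s(i, j), h⟩ := by
  unfold extE
  rw [dif_neg (by simpa using h)]

def gram2 {m : ℕ} {R : Type} [CommRing R] (x : Edge (m + 1) → R) : Matrix (Fin m) (Fin m) R :=
  fun i j => extE x 0 i.succ + extE x 0 j.succ - extE x i.succ j.succ

theorem gram2_symm {m : ℕ} {R : Type} [CommRing R] (x : Edge (m + 1) → R) (i j : Fin m) :
    gram2 x i j = gram2 x j i := by
  unfold gram2
  rw [extE_comm x i.succ j.succ]; ring

theorem extE_map {n : ℕ} {R S : Type} [CommRing R] [CommRing S] (φ : R →+* S) (x : Edge n → R)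
    (i j : Fin n) : φ (extE x i j) = extE (fun e => φ (x e)) i j := by
  unfold extE
  split_ifs <;> simp

theorem gram2_map {m : ℕ} {R S : Type} [CommRing R] [CommRing S] (φ : R →+* S)
    (x : Edge (m + 1) → R) (i j : Fin m) :
    φ (gram2 x i j) = gram2 (fun e => φ (x e)) i j := by
  simp [gram2, extE_map]

/-- generic squared length -/
def sqL {n d : ℕ} {R : Type} [CommRing R] (p : Fin n → Fin d → R) : Sym2 (Fin n) → R :=
  Sym2.lift ⟨fun i j => ∑ k, (p i k - p j k) ^ 2,
    fun i j => Finset.sum_congr rfl fun k _ => by ring⟩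

theorem sqL_mk {n d : ℕ} {R : Type} [CommRing R] (p : Fin n → Fin d → R) (i j : Fin n) :
    sqL p s(i, j) = ∑ k, (p i k - p j k) ^ 2 := rfl

theorem cSqLen_eq {n d : ℕ} (p : Fin n → Fin d → ℂ) : cSqLen p = sqL p := rfl

theorem sqL_map {n d : ℕ} {R S : Type} [CommRing R] [CommRing S] (φ : R →+* S)
    (p : Fin n → Fin d → R) (e : Sym2 (Fin n)) :
    φ (sqL p e) = sqL (fun i k => φ (p i k)) e := by
  induction e using Sym2.ind with
  | _ i j => simp [sqL_mk]

theorem extE_sqL {n d : ℕ} {R : Type} [CommRing R] (p : Fin n → Fin d → R) (i j : Fin n) :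
    extE (fun e => sqL p e.val) i j = ∑ k, (p i k - p j k) ^ 2 := by
  unfold extE
  split_ifs with h
  · subst h; simp
  · rfl

theorem gram2_sqL {m d : ℕ} {R : Type} [CommRing R] (p : Fin (m + 1) → Fin d → R) (i j : Fin m) :
    gram2 (fun e => sqL p e.val) i j =
      2 * ∑ k, (p i.succ k - p 0 k) * (p j.succ k - p 0 k) := by
  simp only [gram2, extE_sqL, Finset.mul_sum, ← Finset.sum_add_distrib, ← Finset.sum_sub_distrib]
  exact Finset.sum_congr rfl fun k _ => by ring

theorem mem_Mvar_of_gram {m d : ℕ} (w : Edge (m + 1) → ℂ) (Q : Fin m → Fin d → ℂ)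
    (h : ∀ i j, gram2 w i j = 2 * ∑ k, Q i k * Q j k) : w ∈ Mvar d (m + 1) := by
  have h0 : ∀ i : Fin m, extE w 0 i.succ = ∑ k, Q i k * Q i k := by
    intro i
    have := h i i
    simp only [gram2, extE_self] at this
    linear_combination this / 2
  have h1 : ∀ i j : Fin m, extE w i.succ j.succ = ∑ k, (Q i k - Q j k) ^ 2 := by
    intro i j
    have := h i j
    simp only [gram2, h0] at this
    have h2 : ∑ k, (Q i k - Q j k) ^ 2 = ∑ k, Q i k * Q i k + ∑ k, Q j k * Q j k -
        2 * ∑ k, Q i k * Q j k := by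
      simp only [Finset.mul_sum, ← Finset.sum_add_distrib, ← Finset.sum_sub_distrib]
      exact Finset.sum_congr rfl fun k _ => by ring
    rw [h2]
    linear_combination -this
  let p : Fin (m + 1) → Fin d → ℂ := Fin.cons 0 Q
  refine ⟨p, ?_⟩
  have key : ∀ i j, extE w i j = ∑ k, (p i k - p j k) ^ 2 := by
    intro i j
    refine Fin.cases ?_ (fun i => ?_) i <;> refine Fin.cases ?_ (fun j => ?_) j
    · simp [extE_self]
    · simp only [p, Fin.cons_zero, Fin.cons_succ, h0]
      refine Finset.sum_congr rfl fun k _ => ?_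
      simp only [Pi.zero_apply]
      ring
    · simp only [p, Fin.cons_zero, Fin.cons_succ]
      rw [extE_comm, h0]
      refine Finset.sum_congr rfl fun k _ => ?_
      simp only [Pi.zero_apply]
      ring
    · simpa only [p, Fin.cons_succ] using h1 i j
  rintro ⟨e, he⟩
  induction e using Sym2.ind with
  | _ i j =>
    rw [← extE_ne w i j he, key, cSqLen_eq]
    rfl

theorem sym_factor {m d : ℕ} (G : Matrix (Fin m) (Fin m) ℂ) (hG : ∀ i j, G i j = G j i)
    (hr : G.rank ≤ d) : ∃ Q : Fin m → Fin d → ℂ, ∀ i j, G i j = ∑ k, Q i k * Q j k := by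
  classical
  obtain ⟨B, hBd⟩ : ∃ B : LinearMap.BilinForm ℂ (Fin m → ℂ), B = Matrix.toBilin' G := ⟨_, rfl⟩
  have hB : LinearMap.IsSymm B := by
    constructor
    intro x y
    simp only [hBd, Matrix.toBilin'_apply, RingHom.id_apply]
    rw [Finset.sum_comm]
    refine Finset.sum_congr rfl fun i _ => Finset.sum_congr rfl fun j _ => ?_
    rw [hG j i]; ring
  obtain ⟨v, hv⟩ := LinearMap.BilinForm.exists_orthogonal_basis hB
  generalize Module.finrank ℂ (Fin m → ℂ) = N at v hv
  have hv' : ∀ a b, a ≠ b → B (v a) (v b) = 0 := fun a b hab => hv hab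
  have hexp : ∀ x y, B x y = ∑ k, v.repr x k * v.repr y k * B (v k) (v k) := by
    intro x y
    conv_lhs => rw [← v.sum_repr x, ← v.sum_repr y]
    simp only [map_sum, LinearMap.sum_apply, map_smul, LinearMap.smul_apply, smul_eq_mul]
    refine Finset.sum_congr rfl fun k _ => ?_
    rw [Finset.sum_eq_single k]
    · ring
    · intro b _ hb; rw [hv' _ _ hb]; simp
    · simp
  let J := {k : Fin N // B (v k) (v k) ≠ 0}
  have hli : LinearIndependent ℂ (fun k : J => (⟨G.mulVecLin (v k.1), LinearMap.mem_range_self _ _⟩ :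
      LinearMap.range G.mulVecLin)) := by
    rw [Fintype.linearIndependent_iff]
    intro c hc j
    have h1 := congrArg (fun z : LinearMap.range G.mulVecLin => (v j.1) ⬝ᵥ (z : Fin m → ℂ)) hc
    simp only [Submodule.coe_sum, Submodule.coe_smul, Submodule.coe_zero, dotProduct_zero,
      dotProduct_sum, dotProduct_smul, Matrix.mulVecLin_apply] at h1
    have h2 : ∀ x y, x ⬝ᵥ G.mulVec y = B x y := by
      intro x y; rw [hBd]; exact (Matrix.toBilin'_apply' G x y).symm
    simp only [h2] at h1
    rw [Finset.sum_eq_single j] at h1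
    · exact (mul_eq_zero.1 h1).resolve_right j.2
    · intro b _ hb
      rw [hv' _ _ (fun h => hb (Subtype.ext h.symm))]; simp
    · simp
  have hcard : Fintype.card J ≤ Fintype.card (Fin d) := by
    rw [Fintype.card_fin]
    exact hli.fintype_card_le_finrank.trans hr
  obtain ⟨f⟩ := Function.Embedding.nonempty_of_card_le hcard
  choose sq hsq using fun z : ℂ => IsSquare.exists_sq z (IsAlgClosed.exists_eq_mul_self z)
  refine ⟨fun i => Function.extend f (fun k : J => v.repr (Pi.single i 1) k.1 * sq (B (v k.1) (v k.1))) 0, ?_⟩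
  intro i j
  have h1 : G i j = B (Pi.single i 1) (Pi.single j 1) := by
    simp [hBd, Matrix.toBilin'_single]
  rw [h1, hexp]
  rw [← Fintype.sum_of_injective f f.injective (fun k : J => v.repr (Pi.single i 1) k.1 *
    v.repr (Pi.single j 1) k.1 * B (v k.1) (v k.1)) _ ?_ ?_]
  · symm
    refine Fintype.sum_of_injective (Subtype.val : J → Fin N) Subtype.val_injective _ _ ?_ ?_
    · intro k hk
      have : B (v k) (v k) = 0 := by
        by_contra h; exact hk ⟨⟨k, h⟩, rfl⟩
      simp [this]
    · intro k; rfl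
  · intro k hk
    beta_reduce
    rw [Function.extend_apply' _ _ _ (by simpa using hk)]
    simp
  · intro k
    beta_reduce
    rw [f.injective.extend_apply, f.injective.extend_apply]
    conv_lhs => rw [hsq (B (v k.1) (v k.1))]
    ring

theorem exists_cols {a b r : ℕ} (G : Matrix (Fin a) (Fin b) ℂ) (hr : r ≤ G.rank) :
    ∃ c : Fin r → Fin b, LinearIndependent ℂ (fun k : Fin r => G.col (c k)) := by
  obtain ⟨κ, f, hf, hs, hl⟩ := exists_linearIndependent' ℂ G.col
  have : Finite κ := Finite.of_injective f hf
  have := Fintype.ofFinite κ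
  have h1 : Fintype.card κ = G.rank := by
    rw [Matrix.rank_eq_finrank_span_cols, ← hs, finrank_span_eq_card hl]
  obtain ⟨g⟩ := Function.Embedding.nonempty_of_card_le (α := Fin r) (β := κ) (by simpa [h1] using hr)
  exact ⟨fun k => f (g k), hl.comp g g.injective⟩

theorem exists_minor {a b r : ℕ} (G : Matrix (Fin a) (Fin b) ℂ) (hr : r ≤ G.rank) :
    ∃ (u : Fin r → Fin a) (c : Fin r → Fin b), (G.submatrix u c).det ≠ 0 := by
  obtain ⟨c, hc⟩ := exists_cols G hr
  have h1 : r ≤ (G.submatrix id c).transpose.rank := by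
    have : LinearIndependent ℂ (G.submatrix id c).transpose.row := hc
    rw [this.rank_matrix]; simp
  obtain ⟨u, hu⟩ := exists_cols _ h1
  refine ⟨u, c, ?_⟩
  have : LinearIndependent ℂ (G.submatrix u c).row := hu
  rw [Matrix.linearIndependent_rows_iff_isUnit, Matrix.isUnit_iff_isUnit_det] at this
  exact this.ne_zero

theorem minor_zero {m d : ℕ} {R : Type} [Field R] (G : Matrix (Fin m) (Fin m) R)
    (Q : Matrix (Fin m) (Fin d) R) (c : R) (hG : ∀ i j, G i j = c * ∑ k, Q i k * Q j k)
    (u v : Fin (d + 1) → Fin m) : (G.submatrix u v).det = 0 := by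
  by_contra h
  have hu : IsUnit (G.submatrix u v) := (Matrix.isUnit_iff_isUnit_det _).2 (Ne.isUnit h)
  have h1 := Matrix.rank_of_isUnit _ hu
  have h2 : G.submatrix u v =
      (c • Q.submatrix u id) * (Q.submatrix v id).transpose := by
    ext i j
    rw [Matrix.mul_apply, Matrix.submatrix_apply, hG]
    simp [Finset.mul_sum, mul_assoc]
  rw [h2] at h1
  have h3 := (Matrix.rank_mul_le_left (c • Q.submatrix u id) (Q.submatrix v id).transpose).trans
    (Matrix.rank_le_width _)
  rw [h1] at h3
  simp at h3

theorem isVariety_M (d m : ℕ) : IsVariety (Mvar d (m + 1)) := by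
  classical
  refine ⟨Finset.univ.image fun uc : (Fin (d + 1) → Fin m) × (Fin (d + 1) → Fin m) =>
    ((gram2 (X : Edge (m + 1) → MvPolynomial (Edge (m+1)) ℂ)).submatrix uc.1 uc.2).det, ?_⟩
  have hev : ∀ (w : Edge (m + 1) → ℂ) (u c : Fin (d + 1) → Fin m),
      eval w ((gram2 (X : Edge (m + 1) → MvPolynomial (Edge (m+1)) ℂ)).submatrix u c).det =
      ((gram2 w).submatrix u c).det := by
    intro w u c
    rw [RingHom.map_det]
    congr 1
    ext i j
    simp [gram2_map]
  ext w
  rw [Set.mem_ofPred_eq]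
  simp only [Finset.forall_mem_image, Finset.mem_univ, forall_const, hev, Prod.forall]
  constructor
  · rintro ⟨p, hp⟩ u c
    have : w = fun e => sqL p e.val := funext hp
    rw [this]
    exact minor_zero _ (Matrix.of fun i k => p i.succ k - p 0 k) 2 (gram2_sqL p) u c
  · intro h
    have hr : (gram2 w).rank ≤ d := by
      by_contra hcon
      obtain ⟨u, c, huc⟩ := exists_minor (gram2 w) (r := d + 1) (by omega)
      exact huc (h u c)
    obtain ⟨Q, hQ⟩ := sym_factor (gram2 w) (gram2_symm w) hr
    obtain ⟨z, hz⟩ := IsAlgClosed.exists_eq_mul_self (1 / 2 : ℂ)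
    refine mem_Mvar_of_gram w (fun i k => z * Q i k) ?_
    intro i j
    rw [hQ, Finset.mul_sum]
    refine Finset.sum_congr rfl fun k _ => ?_
    linear_combination -2 * (Q i k * Q j k) * (-hz)

theorem isVariety_L (d m : ℕ) : IsVariety (Lvar d (m + 1)) := by
  classical
  obtain ⟨S, hS⟩ := isVariety_M d m
  refine ⟨S.image (expand 2), ?_⟩
  ext x
  unfold Lvar
  rw [hS]
  simp only [Set.mem_preimage, Set.mem_ofPred_eq, Finset.forall_mem_image]
  refine forall₂_congr fun f _ => ?_
  have := aeval_expand_two (k := ℂ) x f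
  rw [aeval_eq_eval, aeval_eq_eval] at this
  rw [show eval x (expand 2 f) = _ from this]
  rfl

end gramsec


section idealL
open MvPolynomial

noncomputable def mP (d n : ℕ) (k : Type) [CommRing k] (e : Edge n) :
    MvPolynomial (Fin n × Fin d) k := sqL (fun i l => X (i, l)) e.val

theorem aeval_mP {d n : ℕ} {k R : Type} [CommRing k] [CommRing R] [Algebra k R]
    (p : Fin n × Fin d → R) (e : Edge n) :
    aeval p (mP d n k e) = sqL (fun i l => p (i, l)) e.val := by
  have := sqL_map (aeval (R := k) p).toRingHom (fun i l => X (i, l)) e.val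
  simpa [mP] using this

theorem mP_ne_zero {d n : ℕ} (hd : 1 ≤ d) (e : Edge n) : mP d n ℂ e ≠ 0 := by
  intro h
  have h1 := fun p => aeval_mP (k := ℂ) (R := ℂ) (d := d) p e
  rw [h] at h1
  obtain ⟨e, he⟩ := e
  induction e using Sym2.ind with
  | _ i j =>
    have hij : j ≠ i := by simpa [eq_comm] using he
    have := h1 (fun a => if a.1 = i then 1 else 0)
    simp only [map_zero, sqL_mk] at this
    simp [hij] at this
    have h3 : d = 0 := by exact_mod_cast this.symm
    omega

theorem aeval_aeval_mP {d n : ℕ} {k R : Type} [CommRing k] [CommRing R] [Algebra k R]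
    (p : Fin n × Fin d → R) (h : MvPolynomial (Edge n) k) :
    aeval p (aeval (mP d n k) h) = aeval (fun e : Edge n => sqL (fun i l => p (i, l)) e.val) h := by
  have : (aeval p).comp (aeval (mP d n k)) =
      aeval (R := k) (fun e : Edge n => sqL (fun i l => p (i, l)) e.val) := by
    ext e
    simp [aeval_mP]
  rw [← this]; rfl

theorem mem_M_sqL {d n : ℕ} (p : Fin n × Fin d → ℂ) :
    (fun e : Edge n => sqL (fun i l => p (i, l)) e.val) ∈ Mvar d n :=
  ⟨fun i l => p (i, l), fun _ => rfl⟩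

theorem L_vanish_coeffs {d n : ℕ} (hd : 1 ≤ d) {f : MvPolynomial (Edge n) ℂ}
    {h : Finset (Edge n) → MvPolynomial (Edge n) ℂ}
    (hf : f = ∑ S, (∏ e ∈ S, X e) * expand 2 (h S))
    (hv : ∀ x ∈ Lvar d n, aeval x f = 0) (S : Finset (Edge n)) : aeval (mP d n ℂ) (h S) = 0 := by
  have key : (∏ e ∈ S, mP d n ℂ e) * aeval (mP d n ℂ) (h S) = 0 := by
    apply MvPolynomial.funext
    intro p
    choose x hx using fun e : Edge n => IsAlgClosed.exists_eq_mul_self (sqL (fun i l => p (i, l)) e.val)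
    have hx2 : (fun e => x e ^ 2) = (fun e : Edge n => sqL (fun i l => p (i, l)) e.val) := by
      ext e; rw [hx e, sq]
    have h1 := signs x hf (by
      intro g
      apply hv
      change sqMap _ ∈ Mvar d n
      have : sqMap (fun e => (((g e : ℤˣ) : ℤ) : ℂ) * x e) = fun e => x e ^ 2 := by
        ext e
        rcases Int.units_eq_one_or (g e) with h | h <;> simp [h, sqMap]
      rw [this, hx2]
      exact mem_M_sqL p) S
    rw [hx2, ← aeval_aeval_mP] at h1
    change aeval p _ = aeval p 0
    rw [map_mul, map_prod, map_zero]
    rcases mul_eq_zero.1 h1 with h2 | h2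
    · obtain ⟨e, he, h3⟩ := Finset.prod_eq_zero_iff.1 h2
      rw [Finset.prod_eq_zero he, zero_mul]
      rw [aeval_mP, hx e, h3, zero_mul]
    · rw [h2, mul_zero]
  refine (mul_eq_zero.1 key).resolve_left (Finset.prod_ne_zero_iff.2 fun e _ => mP_ne_zero hd e)

theorem L_vanish_of_coeffs {d n : ℕ} {f : MvPolynomial (Edge n) ℂ}
    {h : Finset (Edge n) → MvPolynomial (Edge n) ℂ}
    (hf : f = ∑ S, (∏ e ∈ S, X e) * expand 2 (h S))
    (hS : ∀ S, aeval (mP d n ℂ) (h S) = 0) : ∀ x ∈ Lvar d n, aeval x f = 0 := by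
  rintro x ⟨p, hp⟩
  rw [aeval_decomp x hf]
  refine Finset.sum_eq_zero fun S _ => ?_
  have h1 : (fun e => x e ^ 2) = (fun e : Edge n => sqL p e.val) := funext hp
  rw [h1]
  have := aeval_aeval_mP (k := ℂ) (fun a : Fin n × Fin d => p a.1 a.2) (h S)
  rw [hS, map_zero] at this
  rw [← this, mul_zero]

variable {d n : ℕ} {F : Type} [Field F] [Algebra (MvPolynomial (Fin n × Fin d) ℂ) F]
  [Algebra ℂ F] [IsScalarTower ℂ (MvPolynomial (Fin n × Fin d) ℂ) F]
  [FaithfulSMul (MvPolynomial (Fin n × Fin d) ℂ) F]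

theorem aeval_y {y : Edge n → F}
    (hy : ∀ e, y e ^ 2 = algebraMap (MvPolynomial (Fin n × Fin d) ℂ) F (mP d n ℂ e))
    {f : MvPolynomial (Edge n) ℂ} {h : Finset (Edge n) → MvPolynomial (Edge n) ℂ}
    (hf : f = ∑ S, (∏ e ∈ S, X e) * expand 2 (h S)) :
    aeval y f = ∑ S, (∏ e ∈ S, y e) * algebraMap _ F (aeval (mP d n ℂ) (h S)) := by
  rw [aeval_decomp y hf]
  refine Finset.sum_congr rfl fun S _ => ?_
  rw [funext hy]
  congr 1
  exact aeval_algebraMap_apply F _ _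

theorem gy_sq {y : Edge n → F}
    (hy : ∀ e, y e ^ 2 = algebraMap (MvPolynomial (Fin n × Fin d) ℂ) F (mP d n ℂ e))
    (g : Edge n → ℤˣ) (e : Edge n) : ((((g e : ℤˣ) : ℤ) : F) * y e) ^ 2 =
      algebraMap (MvPolynomial (Fin n × Fin d) ℂ) F (mP d n ℂ e) := by
  rw [← hy]
  rcases Int.units_eq_one_or (g e) with h | h <;> simp [h]

theorem y_ne {y : Edge n → F} (hd : 1 ≤ d)
    (hy : ∀ e, y e ^ 2 = algebraMap (MvPolynomial (Fin n × Fin d) ℂ) F (mP d n ℂ e))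
    (e : Edge n) : y e ≠ 0 := by
  intro h
  have := hy e
  rw [h, zero_pow two_ne_zero] at this
  exact mP_ne_zero hd e ((FaithfulSMul.algebraMap_eq_zero_iff _ F).1 this.symm)

theorem vanishing_le {y : Edge n → F} (hd : 1 ≤ d)
    (hy : ∀ e, y e ^ 2 = algebraMap (MvPolynomial (Fin n × Fin d) ℂ) F (mP d n ℂ e)) :
    vanishingIdeal ℂ (Lvar d n) ≤ RingHom.ker (aeval (R := ℂ) y) := by
  intro f hf
  obtain ⟨h, hh⟩ := exists_decomp f
  rw [RingHom.mem_ker, aeval_y hy hh]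
  refine Finset.sum_eq_zero fun S _ => ?_
  rw [L_vanish_coeffs hd hh hf, map_zero, mul_zero]

theorem vanishing_ge {y : Edge n → F} (hd : 1 ≤ d)
    (hy : ∀ e, y e ^ 2 = algebraMap (MvPolynomial (Fin n × Fin d) ℂ) F (mP d n ℂ e)) :
    (Finset.univ : Finset (Edge n → ℤˣ)).inf (fun g =>
      RingHom.ker (aeval (R := ℂ) (fun e => (((g e : ℤˣ) : ℤ) : F) * y e))) ≤
      vanishingIdeal ℂ (Lvar d n) := by
  intro f hf
  have : CharZero F := charZero_of_injective_algebraMap (algebraMap ℂ F).injective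
  rw [Submodule.mem_finsetInf] at hf
  obtain ⟨h, hh⟩ := exists_decomp f
  apply L_vanish_of_coeffs hh
  intro S
  have h1 := signs y hh (fun g => hf g (Finset.mem_univ g)) S
  rw [funext hy] at h1
  replace h1 : (∏ e ∈ S, y e) * algebraMap _ F (aeval (mP d n ℂ) (h S)) = 0 := by
    rw [← aeval_algebraMap_apply F (mP d n ℂ) (h S)]; exact h1
  refine (FaithfulSMul.algebraMap_eq_zero_iff _ F).1 ((mul_eq_zero.1 h1).resolve_left ?_)
  exact Finset.prod_ne_zero_iff.2 fun e _ => y_ne hd hy e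

theorem component_eq {y : Edge n → F} (hd : 1 ≤ d)
    (hy : ∀ e, y e ^ 2 = algebraMap (MvPolynomial (Fin n × Fin d) ℂ) F (mP d n ℂ e))
    (hL : IsVariety (Lvar d n)) (W : Set (Edge n → ℂ)) (hW : IsComponent (Lvar d n) W) :
    ∃ z : Edge n → F, (∀ e, z e ^ 2 = algebraMap (MvPolynomial (Fin n × Fin d) ℂ) F (mP d n ℂ e)) ∧
      W = zeroLocus ℂ (RingHom.ker (aeval (R := ℂ) z)) := by
  obtain ⟨hirr, hWL, hmax⟩ := hW
  have hp := (irr_iff.1 hirr).2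
  have h1 := (vanishing_ge hd hy).trans (vanishingIdeal_anti_mono hWL)
  obtain ⟨g, -, hg⟩ := (Ideal.IsPrime.inf_le' hp).1 h1
  refine ⟨_, gy_sq hy g, ?_⟩
  symm
  apply hmax
  · have : (RingHom.ker (aeval (R := ℂ) (fun e => (((g e : ℤˣ) : ℤ) : F) * y e))).IsPrime :=
      RingHom.ker_isPrime _
    exact irr_zeroLocus _
  · exact le_zeroLocus_iff_le_vanishingIdeal.2 hg
  · have := zeroLocus_anti_mono (K := ℂ) (vanishing_le hd (gy_sq hy g))
    rwa [hL.zl] at this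

end idealL


section dimsec
open MvPolynomial

def famG {d r : ℕ} {R : Type} [CommRing R] (x : Edge (d + r + 1) → R) :
    Sym2 (Fin d) ⊕ (Fin d × Fin r) → R :=
  Sum.elim (Sym2.lift ⟨fun i j => gram2 x (Fin.castAdd r i) (Fin.castAdd r j),
    fun _ _ => gram2_symm _ _ _⟩) (fun ij => gram2 x (Fin.castAdd r ij.1) (Fin.natAdd d ij.2))

theorem famG_inl {d r : ℕ} {R : Type} [CommRing R] (x : Edge (d + r + 1) → R) (i j : Fin d) :
    famG x (Sum.inl s(i, j)) = gram2 x (Fin.castAdd r i) (Fin.castAdd r j) := rfl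

theorem famG_inr {d r : ℕ} {R : Type} [CommRing R] (x : Edge (d + r + 1) → R) (i : Fin d)
    (j : Fin r) :
    famG x (Sum.inr (i, j)) = gram2 x (Fin.castAdd r i) (Fin.natAdd d j) := rfl

theorem famG_map {d r : ℕ} {R S : Type} [CommRing R] [CommRing S] (φ : R →+* S)
    (x : Edge (d + r + 1) → R) (t : Sym2 (Fin d) ⊕ (Fin d × Fin r)) :
    φ (famG x t) = famG (fun e => φ (x e)) t := by
  rcases t with t | ⟨i, j⟩
  · induction t using Sym2.ind with
    | _ i j => rw [famG_inl, famG_inl, gram2_map]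
  · rw [famG_inr, famG_inr, gram2_map]

noncomputable def symX (d r : ℕ) : Matrix (Fin d) (Fin d)
    (MvPolynomial (Sym2 (Fin d) ⊕ (Fin d × Fin r)) ℂ) :=
  Matrix.of fun i j => X (Sum.inl s(i, j))

theorem aeval_det_symX {d r : ℕ} {R : Type} [CommRing R] [Algebra ℂ R]
    (c : Sym2 (Fin d) ⊕ (Fin d × Fin r) → R) :
    aeval c (symX d r).det = (Matrix.of fun i j => c (Sum.inl s(i, j))).det := by
  rw [AlgHom.map_det]
  congr 1
  ext i j
  simp [symX]

theorem det_symX_ne (d r : ℕ) : (symX d r).det ≠ 0 := by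
  intro h
  have := aeval_det_symX (d := d) (r := r) (R := ℂ)
    (Sum.elim (fun s => if s.IsDiag then 1 else 0) 0)
  rw [h, map_zero] at this
  have h1 : (Matrix.of fun i j : Fin d => (Sum.elim (fun s : Sym2 (Fin d) =>
      if s.IsDiag then (1 : ℂ) else 0) (0 : Fin d × Fin r → ℂ)) (Sum.inl s(i, j))) = 1 := by
    ext i j
    simp [Matrix.one_apply]
  rw [h1, Matrix.det_one] at this
  exact zero_ne_one this

theorem famG_surj {d r : ℕ} (c : Sym2 (Fin d) ⊕ (Fin d × Fin r) → ℂ)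
    (hc : (Matrix.of fun i j => c (Sum.inl s(i, j))).det ≠ 0) :
    ∃ p : Fin (d + r + 1) → Fin d → ℂ, famG (fun e => sqL p e.val) = c := by
  obtain ⟨Q, hQ⟩ := sym_factor (d := d) (Matrix.of fun i j => (1 / 2 : ℂ) * c (Sum.inl s(i, j)))
    (fun i j => by simp [Sym2.eq_swap]) ((Matrix.rank_le_width _))
  let Qm : Matrix (Fin d) (Fin d) ℂ := Matrix.of Q
  have hdet : IsUnit Qm.det := by
    rw [isUnit_iff_ne_zero]
    intro h
    apply hc
    have : (Matrix.of fun i j => c (Sum.inl s(i, j))) = (2 : ℂ) • (Qm * Qm.transpose) := by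
      ext i j
      have := hQ i j
      simp only [Matrix.of_apply] at this
      simp only [Matrix.of_apply, Matrix.smul_apply, Matrix.mul_apply, Matrix.transpose_apply, Qm,
        ← this, smul_eq_mul]
      ring
    rw [this, Matrix.det_smul, Matrix.det_mul, h]
    simp
  let p : Fin (d + r + 1) → Fin d → ℂ := Fin.cons 0 (Fin.addCases Q
    (fun j => Qm⁻¹.mulVec (fun i => (1 / 2 : ℂ) * c (Sum.inr (i, j)))))
  refine ⟨p, ?_⟩
  have p0 : p 0 = 0 := rfl
  have pu : ∀ i : Fin d, p (Fin.castAdd r i).succ = Q i := fun i => by simp [p]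
  have pv : ∀ j : Fin r, p (Fin.natAdd d j).succ =
    Qm⁻¹.mulVec (fun i => (1 / 2 : ℂ) * c (Sum.inr (i, j))) := fun i => by simp [p]
  ext t
  rcases t with t | ⟨i, j⟩
  · induction t using Sym2.ind with
    | _ i j =>
      rw [famG_inl, gram2_sqL, p0, pu, pu]
      have := hQ i j
      simp only [Matrix.of_apply] at this
      simp only [Pi.zero_apply, sub_zero, ← this]
      ring
  · rw [famG_inr, gram2_sqL, p0, pu, pv]
    have : Qm.mulVec (Qm⁻¹.mulVec (fun i => (1 / 2 : ℂ) * c (Sum.inr (i, j)))) i =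
        (1 / 2 : ℂ) * c (Sum.inr (i, j)) := by
      rw [Matrix.mulVec_mulVec, Matrix.mul_nonsing_inv _ hdet, Matrix.one_mulVec]
    simp only [Pi.zero_apply, sub_zero]
    rw [show ∑ k, Q i k * Qm⁻¹.mulVec (fun i => (1 / 2 : ℂ) * c (Sum.inr (i, j))) k =
      (1 / 2 : ℂ) * c (Sum.inr (i, j)) from this]
    ring

theorem famG_indep (d r : ℕ) : AlgebraicIndependent ℂ (famG (mP d (d + r + 1) ℂ)) := by
  rw [algebraicIndependent_iff]
  intro f hf
  have : f * (symX d r).det = 0 := by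
    apply MvPolynomial.funext
    intro c
    change aeval c _ = aeval c 0
    rw [map_mul, map_zero, aeval_det_symX]
    by_cases hc : (Matrix.of fun i j => c (Sum.inl s(i, j))).det = 0
    · rw [hc, mul_zero]
    · obtain ⟨p, hp⟩ := famG_surj c hc
      have h1 : (aeval (R := ℂ) (fun a : Fin (d + r + 1) × Fin d => p a.1 a.2)).comp
          (aeval (famG (mP d (d + r + 1) ℂ))) = aeval (R := ℂ) c := by
        ext t
        simp only [AlgHom.comp_apply, aeval_X]
        have := famG_map (aeval (R := ℂ) (fun a : Fin (d + r + 1) × Fin d => p a.1 a.2)).toRingHom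
          (mP d (d + r + 1) ℂ) t
        refine this.trans ?_
        rw [← hp]
        congr 1
        ext e
        exact aeval_mP _ e
      have h2 := congrArg (aeval (R := ℂ) (fun a : Fin (d + r + 1) × Fin d => p a.1 a.2)) hf
      rw [map_zero] at h2
      rw [← h1, AlgHom.comp_apply, h2, zero_mul]
  exact (mul_eq_zero.1 this).resolve_right (det_symX_ne d r)

theorem schur {d r : ℕ} {R : Type} [CommRing R] (Q : Matrix (Fin d) (Fin d) R)
    (S : Matrix (Fin r) (Fin d) R) :
    ((2 : R) • (Q * Q.transpose)).det • ((2 : R) • (S * S.transpose)) =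
      ((2 : R) • (Q * S.transpose)).transpose * ((2 : R) • (Q * Q.transpose)).adjugate *
        ((2 : R) • (Q * S.transpose)) := by
  have h1 : (2 : R) • (Q * Q.transpose) = Q * ((2 : R) • Q.transpose) := by
    rw [Matrix.mul_smul]
  have h2 : ((2 : R) • (Q * S.transpose)).transpose = S * ((2 : R) • Q.transpose) := by
    rw [Matrix.transpose_smul, Matrix.transpose_mul, Matrix.transpose_transpose, Matrix.mul_smul]
  rw [h2, h1]
  generalize (2 : R) • Q.transpose = T
  rw [Matrix.adjugate_mul_distrib, Matrix.mul_smul]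
  have h3 : S * T * (T.adjugate * Q.adjugate) * (Q * S.transpose) =
      S * (T * T.adjugate) * (Q.adjugate * Q) * S.transpose := by
    simp only [Matrix.mul_assoc]
  rw [h3, Matrix.mul_adjugate, Matrix.adjugate_mul, Matrix.det_mul]
  simp only [Matrix.mul_smul, Matrix.smul_mul, Matrix.mul_one, smul_smul]
  congr 1
  ring

def gA {d r : ℕ} {R : Type} [CommRing R] (x : Edge (d + r + 1) → R) : Matrix (Fin d) (Fin d) R :=
  Matrix.of fun i j => famG x (Sum.inl s(i, j))

def gB {d r : ℕ} {R : Type} [CommRing R] (x : Edge (d + r + 1) → R) : Matrix (Fin d) (Fin r) R :=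
  Matrix.of fun i j => famG x (Sum.inr (i, j))

def gD {d r : ℕ} {R : Type} [CommRing R] (x : Edge (d + r + 1) → R) : Matrix (Fin r) (Fin r) R :=
  Matrix.of fun i j => gram2 x (Fin.natAdd d i) (Fin.natAdd d j)

theorem schur_sqL {d r : ℕ} {R : Type} [CommRing R] (p : Fin (d + r + 1) → Fin d → R)
    {x : Edge (d + r + 1) → R} (hx : x = fun e => sqL p e.val) :
    (gA x).det • gD x = (gB x).transpose * (gA x).adjugate * gB x := by
  subst hx
  have := schur (Matrix.of fun (i : Fin d) k => p (Fin.castAdd r i).succ k - p 0 k)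
    (Matrix.of fun (j : Fin r) k => p (Fin.natAdd d j).succ k - p 0 k)
  convert this using 2
  · congr 1
    ext i j
    simp [gA, famG_inl, gram2_sqL, Matrix.mul_apply]
  · ext i j
    simp [gD, gram2_sqL, Matrix.mul_apply]
  · congr 1
    · ext i j
      simp [gB, famG_inr, gram2_sqL, Matrix.mul_apply]
    · congr 1
      ext i j
      simp [gA, famG_inl, gram2_sqL, Matrix.mul_apply]
  · ext i j
    simp [gB, famG_inr, gram2_sqL, Matrix.mul_apply]

theorem gA_map {d r : ℕ} {R S : Type} [CommRing R] [CommRing S] (φ : R →+* S)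
    (x : Edge (d + r + 1) → R) : φ.mapMatrix (gA x) = gA (fun e => φ (x e)) := by
  ext i j; simp [gA, famG_map]

theorem gB_map {d r : ℕ} {R S : Type} [CommRing R] [CommRing S] (φ : R →+* S)
    (x : Edge (d + r + 1) → R) : (gB x).map φ = gB (fun e => φ (x e)) := by
  ext i j; simp [gB, famG_map]

theorem gD_map {d r : ℕ} {R S : Type} [CommRing R] [CommRing S] (φ : R →+* S)
    (x : Edge (d + r + 1) → R) : φ.mapMatrix (gD x) = gD (fun e => φ (x e)) := by
  ext i j; simp [gD, gram2_map]

theorem schur_of_inj {d r : ℕ} {R S : Type} [CommRing R] [CommRing S] (φ : R →+* S)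
    (hφ : Function.Injective φ) (x : Edge (d + r + 1) → R)
    (h : (gA (fun e => φ (x e))).det • gD (fun e => φ (x e)) =
      (gB (fun e => φ (x e))).transpose * (gA (fun e => φ (x e))).adjugate *
        gB (fun e => φ (x e))) :
    (gA x).det • gD x = (gB x).transpose * (gA x).adjugate * gB x := by
  apply Matrix.map_injective hφ
  beta_reduce
  rw [Matrix.map_mul, Matrix.map_mul, gB_map, Matrix.transpose_map, gB_map]
  have h1 : ((gA x).adjugate).map φ = (gA (fun e => φ (x e))).adjugate := by
    rw [← gA_map]; exact RingHom.map_adjugate φ (gA x)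
  rw [h1, ← h, ← gA_map, ← gD_map, ← RingHom.map_det]
  ext i j
  simp

theorem alg_of_mul {R T : Type} [CommRing R] [IsDomain R] [CommRing T] [IsDomain T] [Algebra R T]
    [FaithfulSMul R T] {x : T} (a b : R) (ha : a ≠ 0)
    (h : algebraMap R T a * x = algebraMap R T b) : IsAlgebraic R x := by
  refine ⟨Polynomial.C a * Polynomial.X - Polynomial.C b, ?_, ?_⟩
  · intro h0
    have := congrArg (fun q => Polynomial.coeff q 1) h0
    simp [Polynomial.coeff_C] at this
    exact ha this
  · simp [h]

theorem alg_y {d r : ℕ} {T : Type} [CommRing T] [IsDomain T] [Algebra ℂ T]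
    (y : Edge (d + r + 1) → T)
    (hs : (gA (fun e => y e ^ 2)).det • gD (fun e => y e ^ 2) =
      (gB (fun e => y e ^ 2)).transpose * (gA (fun e => y e ^ 2)).adjugate *
        gB (fun e => y e ^ 2)) (h0 : (gA (fun e => y e ^ 2)).det ≠ 0) (e : Edge (d + r + 1)) :
    IsAlgebraic (Algebra.adjoin ℂ (Set.range (famG fun e => y e ^ 2))) (y e) := by
  set x := fun e => y e ^ 2 with hx
  set S := Algebra.adjoin ℂ (Set.range (famG x)) with hS
  have hAm : ∀ i j, gA x i j ∈ S := fun i j => Algebra.subset_adjoin ⟨Sum.inl s(i, j), rfl⟩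
  have hBm : ∀ i j, gB x i j ∈ S := fun i j => Algebra.subset_adjoin ⟨Sum.inr (i, j), rfl⟩
  let A' : Matrix (Fin d) (Fin d) S := Matrix.of fun i j => ⟨_, hAm i j⟩
  let B' : Matrix (Fin d) (Fin r) S := Matrix.of fun i j => ⟨_, hBm i j⟩
  have hA' : S.val.toRingHom.mapMatrix A' = gA x := by ext i j; rfl
  have hB' : B'.map S.val = gB x := by ext i j; rfl
  let AC := (Subalgebra.algebraicClosure S T).restrictScalars ℂ
  have hSA : ∀ z ∈ S, z ∈ AC := fun z hz => isAlgebraic_algebraMap (⟨z, hz⟩ : S)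
  have hD : ∀ j l, gD x j l ∈ AC := by
    intro j l
    have hdet : S.val A'.det = (gA x).det := by
      rw [← hA']; exact RingHom.map_det S.val.toRingHom A'
    have hadj : A'.adjugate.map S.val = (gA x).adjugate := by
      rw [← hA']; exact RingHom.map_adjugate S.val.toRingHom A'
    refine alg_of_mul A'.det ((B'.transpose * A'.adjugate * B') j l) ?_ ?_
    · intro h; rw [h, map_zero] at hdet; exact h0 hdet.symm
    · change S.val A'.det * gD x j l = ((B'.transpose * A'.adjugate * B').map S.val) j l
      rw [hdet, Matrix.map_mul, Matrix.map_mul, hB', Matrix.transpose_map, hB', hadj, ← hs]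
      simp
  have hgr : ∀ i j, gram2 x i j ∈ AC := by
    intro i j
    induction i using Fin.addCases with
    | left i =>
      induction j using Fin.addCases with
      | left j => exact hSA _ (hAm i j)
      | right j => exact hSA _ (hBm i j)
    | right i =>
      induction j using Fin.addCases with
      | left j => rw [gram2_symm]; exact hSA _ (hBm j i)
      | right j => exact hD i j
  have hx0 : ∀ i : Fin (d + r), extE x 0 i.succ ∈ AC := by
    intro i
    have h1 : extE x 0 i.succ = (1 / 2 : ℂ) • gram2 x i i := by
      simp only [gram2, extE_self, sub_zero, ← two_smul ℂ, smul_smul]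
      norm_num
    rw [h1]
    exact AC.smul_mem (hgr i i) _
  have hxe : ∀ i j : Fin (d + r + 1), extE x i j ∈ AC := by
    intro i j
    refine Fin.cases ?_ (fun i => ?_) i <;> refine Fin.cases ?_ (fun j => ?_) j
    · rw [extE_self]; exact AC.zero_mem
    · exact hx0 j
    · rw [extE_comm]; exact hx0 i
    · have h1 : extE x i.succ j.succ = extE x 0 i.succ + extE x 0 j.succ - gram2 x i j := by
        simp only [gram2]; ring
      rw [h1]
      exact AC.sub_mem (AC.add_mem (hx0 i) (hx0 j)) (hgr i j)
  obtain ⟨e, he⟩ := e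
  induction e using Sym2.ind with
  | _ i j =>
    have h1 := hxe i j
    rw [extE_ne x i j he] at h1
    exact IsAlgebraic.of_pow (n := 2) (by norm_num) h1

theorem dim_y {d r : ℕ} {F : Type} [Field F]
    [Algebra (MvPolynomial (Fin (d + r + 1) × Fin d) ℂ) F]
    [Algebra ℂ F] [IsScalarTower ℂ (MvPolynomial (Fin (d + r + 1) × Fin d) ℂ) F]
    [FaithfulSMul (MvPolynomial (Fin (d + r + 1) × Fin d) ℂ) F] {y : Edge (d + r + 1) → F}
    (hy : ∀ e, y e ^ 2 = algebraMap (MvPolynomial (Fin (d + r + 1) × Fin d) ℂ) F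
      (mP d (d + r + 1) ℂ e)) :
    ringKrullDim (MvPolynomial (Edge (d + r + 1)) ℂ ⧸ RingHom.ker (aeval (R := ℂ) y)) =
      ((d * (d + r + 1) - (d + 1).choose 2 : ℕ) : WithBot ℕ∞) := by
  have hprime : (RingHom.ker (aeval (R := ℂ) y)).IsPrime := RingHom.ker_isPrime _
  let T := MvPolynomial (Edge (d + r + 1)) ℂ ⧸ RingHom.ker (aeval (R := ℂ) y)
  let φ : T →ₐ[ℂ] F := Ideal.kerLiftAlg (aeval (R := ℂ) y)
  have hφ : Function.Injective φ := Ideal.kerLiftAlg_injective _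
  let yb : Edge (d + r + 1) → T := fun e => Ideal.Quotient.mkₐ ℂ _ (X e)
  have hyb : ∀ e, φ (yb e) = y e := by
    intro e
    change Ideal.kerLiftAlg (aeval (R := ℂ) y) (Ideal.Quotient.mk _ (X e)) = y e
    rw [Ideal.kerLiftAlg_mk, aeval_X]
  have hyb2 : (fun e => φ (yb e ^ 2)) = fun e => algebraMap _ F (mP d (d + r + 1) ℂ e) := by
    ext e; rw [map_pow, hyb, hy]
  let ψ := algebraMap (MvPolynomial (Fin (d + r + 1) × Fin d) ℂ) F
  have hψ : Function.Injective ψ := FaithfulSMul.algebraMap_injective _ F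
  have hind : AlgebraicIndependent ℂ (famG fun e => yb e ^ 2) := by
    apply AlgebraicIndependent.of_comp φ
    have h1 : φ ∘ (famG fun e => yb e ^ 2) = (IsScalarTower.toAlgHom ℂ
        (MvPolynomial (Fin (d + r + 1) × Fin d) ℂ) F) ∘ famG (mP d (d + r + 1) ℂ) := by
      ext t
      have h2 := famG_map φ.toRingHom (fun e => yb e ^ 2) t
      have h3 := famG_map ψ (mP d (d + r + 1) ℂ) t
      exact (h2.trans (congrArg (fun z => famG z t) hyb2)).trans h3.symm
    rw [h1]
    exact (famG_indep d r).map' hψ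
  have hs : (gA (fun e => yb e ^ 2)).det • gD (fun e => yb e ^ 2) =
      (gB (fun e => yb e ^ 2)).transpose * (gA (fun e => yb e ^ 2)).adjugate *
        gB (fun e => yb e ^ 2) := by
    apply schur_of_inj φ.toRingHom hφ
    change (gA (fun e => φ (yb e ^ 2))).det • gD (fun e => φ (yb e ^ 2)) =
      (gB (fun e => φ (yb e ^ 2))).transpose * (gA (fun e => φ (yb e ^ 2))).adjugate *
        gB (fun e => φ (yb e ^ 2))
    rw [hyb2]
    apply schur_sqL (fun i k => ψ (X (i, k)))
    ext e
    exact sqL_map ψ _ _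
  have h0 : (gA (fun e => yb e ^ 2)).det ≠ 0 := by
    intro h
    rw [algebraicIndependent_iff] at hind
    apply det_symX_ne d r
    apply hind
    rw [aeval_det_symX]
    exact h
  have hgen : Algebra.adjoin ℂ (Set.range yb) = ⊤ := by
    have h1 : (Ideal.Quotient.mkₐ ℂ (RingHom.ker (aeval (R := ℂ) y))).range = ⊤ :=
      (AlgHom.range_eq_top _).2 (Ideal.Quotient.mkₐ_surjective _ _)
    rw [← h1, ← Algebra.map_top, ← adjoin_range_X, AlgHom.map_adjoin, ← Set.range_comp]
    rfl
  have htr := trdeg_of yb hgen _ hind (alg_y yb hs h0)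
  rw [dim_of_trdeg _ htr]
  congr 2
  rw [Fintype.card_sum, Sym2.card, Fintype.card_prod, Fintype.card_fin, Fintype.card_fin]
  have h2 : (d + 1).choose 2 * 2 = (d + 1) * d := by
    rw [Nat.choose_two_right]
    exact Nat.div_mul_cancel (Nat.even_mul_pred_self (d + 1)).two_dvd
  have h3 : d * (d + r + 1) = (d + 1) * d + d * r := by ring
  omega

end dimsec


section irrsec
open MvPolynomial

theorem sqL_two {n d : ℕ} (hd : 2 ≤ d) {R : Type} [CommRing R] (α β : Fin n → R) (a b : Fin n) :
    sqL (fun a (k : Fin d) => if k.1 = 0 then α a else if k.1 = 1 then β a else 0) s(a, b) =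
      (α a - α b) ^ 2 + (β a - β b) ^ 2 := by
  obtain ⟨d, rfl⟩ := Nat.exists_eq_add_of_le' hd
  rw [sqL_mk, Fin.sum_univ_succ, Fin.sum_univ_succ]
  simp

theorem prod_not_square {n d : ℕ} (hd : 2 ≤ d) (S : Finset (Edge n)) (hS : S.Nonempty)
    (q : MvPolynomial (Fin n × Fin d) ℂ) (hq : q * q = ∏ e ∈ S, mP d n ℂ e) : False := by
  obtain ⟨⟨e, he⟩, heS⟩ := hS
  induction e using Sym2.ind with
  | _ i j =>
  have hij : i ≠ j := by simpa using he
  let α : Fin n → Polynomial ℂ := fun a => if a = i then 0 else if a = j then 1 + Polynomial.X else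
    Polynomial.C ((a.1 : ℂ) + 3)
  let β : Fin n → Polynomial ℂ := fun a => if a = j then Polynomial.C Complex.I else 0
  let φ := aeval (R := ℂ) (fun a : Fin n × Fin d =>
    if a.2.1 = 0 then α a.1 else if a.2.1 = 1 then β a.1 else 0)
  have hφ : ∀ a b (h : ¬ (s(a, b) : Sym2 (Fin n)).IsDiag), φ (mP d n ℂ ⟨s(a, b), h⟩) =
      (α a - α b) ^ 2 + (β a - β b) ^ 2 := by
    intro a b h
    rw [aeval_mP]
    exact sqL_two hd α β a b
  have hI : (Polynomial.C Complex.I : Polynomial ℂ) ^ 2 = -1 := by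
    rw [← Polynomial.C_pow, Complex.I_sq]; simp
  have h1 : φ (mP d n ℂ ⟨s(i, j), he⟩) = Polynomial.X * (Polynomial.X + 2) := by
    rw [hφ]
    simp only [α, β, if_true, if_neg hij, if_neg hij.symm]
    linear_combination hI
  have h2 : ∀ e : Edge n, e ≠ ⟨s(i, j), he⟩ → (φ (mP d n ℂ e)).eval 0 ≠ 0 := by
    rintro ⟨e, he'⟩ hne
    induction e using Sym2.ind with
    | _ a b =>
    have hab : a ≠ b := by simpa using he'
    have hne' : ¬ ((a = i ∧ b = j) ∨ (a = j ∧ b = i)) := by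
      intro h; apply hne; apply Subtype.ext; simpa using h
    rw [hφ]
    have c3 : ∀ c : Fin n, (c.1 : ℂ) + 3 ≠ 0 := fun c => by exact_mod_cast (by omega : c.1 + 3 ≠ 0)
    have c1 : ∀ c : Fin n, (c.1 : ℂ) + 1 ≠ 0 := fun c => by exact_mod_cast (by omega : c.1 + 1 ≠ 0)
    have hα : ∀ c, (α c).eval 0 = if c = i then 0 else if c = j then 1 else (c.1 : ℂ) + 3 := by
      intro c; simp only [α]; split_ifs <;> simp
    have hβ : ∀ c, (β c).eval 0 = if c = j then Complex.I else 0 := by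
      intro c; simp only [β]; split_ifs <;> simp
    simp only [Polynomial.eval_add, Polynomial.eval_pow, Polynomial.eval_sub, hα, hβ]
    have hcast : (a.1 : ℂ) ≠ b.1 := by
      intro h; exact hab (Fin.ext (by exact_mod_cast h))
    by_cases haj : a = j
    · subst haj
      have hbi : b ≠ i := fun h => hne' (Or.inr ⟨rfl, h⟩)
      rw [if_neg hij.symm, if_pos rfl, if_neg hbi, if_neg hab.symm, if_pos rfl, if_neg hab.symm]
      have : (1 - ((b.1 : ℂ) + 3)) ^ 2 + (Complex.I - 0) ^ 2 = ((b.1 : ℂ) + 1) * (b.1 + 3) := by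
        linear_combination Complex.I_sq
      rw [this]
      exact mul_ne_zero (c1 b) (c3 b)
    · by_cases hbj : b = j
      · subst hbj
        have hai : a ≠ i := fun h => hne' (Or.inl ⟨h, rfl⟩)
        rw [if_neg hai, if_neg haj, if_neg hij.symm, if_pos rfl, if_neg haj, if_pos rfl]
        have : (((a.1 : ℂ) + 3) - 1) ^ 2 + (0 - Complex.I) ^ 2 = ((a.1 : ℂ) + 1) * (a.1 + 3) := by
          linear_combination Complex.I_sq
        rw [this]
        exact mul_ne_zero (c1 a) (c3 a)
      · rw [if_neg haj, if_neg hbj, if_neg haj, if_neg hbj]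
        simp only [sub_zero, ne_eq, zero_pow two_ne_zero, add_zero]
        apply pow_ne_zero
        by_cases hai : a = i
        · rw [if_pos hai, if_neg (fun h => hab (hai.trans h.symm)), zero_sub]
          exact neg_ne_zero.2 (c3 b)
        · rw [if_neg hai]
          by_cases hbi : b = i
          · rw [if_pos hbi, sub_zero]; exact c3 a
          · rw [if_neg hbi]
            intro h
            apply hcast
            linear_combination h
  have h3 := congrArg φ hq
  rw [map_mul, map_prod, ← Finset.mul_prod_erase S _ heS, h1] at h3
  have h4 : Polynomial.X ∣ φ q := by
    have : Polynomial.X ∣ φ q * φ q := by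
      rw [h3, mul_assoc]; exact dvd_mul_right _ _
    rcases Polynomial.prime_X.dvd_or_dvd this with h | h <;> exact h
  obtain ⟨z, hz⟩ := h4
  rw [hz, mul_assoc, mul_assoc] at h3
  have h5 := mul_left_cancel₀ Polynomial.X_ne_zero h3
  have h6 := congrArg (Polynomial.eval 0) h5
  simp only [Polynomial.eval_mul, Polynomial.eval_X, Polynomial.eval_add, zero_add,
    Polynomial.eval_prod, zero_mul, mul_zero] at h6
  have h7 := mul_eq_zero.1 h6.symm
  rcases h7 with h7 | h7
  · simp at h7
  · obtain ⟨e, heE, h8⟩ := Finset.prod_eq_zero_iff.1 h7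
    exact h2 e (Finset.ne_of_mem_erase heE) h8

theorem not_square_K {n d : ℕ} (hd : 2 ≤ d) (S : Finset (Edge n)) (hS : S.Nonempty) :
    ¬ IsSquare (∏ e ∈ S, algebraMap (MvPolynomial (Fin n × Fin d) ℂ)
      (FractionRing (MvPolynomial (Fin n × Fin d) ℂ)) (mP d n ℂ e)) := by
  rintro ⟨b, hb⟩
  have h1 : IsIntegral (MvPolynomial (Fin n × Fin d) ℂ) (b ^ 2) := by
    rw [sq, ← hb, ← map_prod]; exact isIntegral_algebraMap
  obtain ⟨q, hq⟩ := IsIntegrallyClosed.exists_algebraMap_eq_of_isIntegral_pow (n := 2) (by norm_num) h1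
  refine prod_not_square hd S hS q ?_
  apply IsFractionRing.injective (MvPolynomial (Fin n × Fin d) ℂ)
      (FractionRing (MvPolynomial (Fin n × Fin d) ℂ))
  rw [map_mul, hq, map_prod, ← hb]

theorem vanishing_prime {n d : ℕ} (hd : 2 ≤ d) : (vanishingIdeal ℂ (Lvar d n)).IsPrime := by
  let A := MvPolynomial (Fin n × Fin d) ℂ
  let K := FractionRing A
  let F := AlgebraicClosure K
  have : CharZero K := charZero_of_injective_algebraMap (algebraMap ℂ K).injective
  have : IsGalois K F := IsAlgClosure.isGalois K F
  have : FaithfulSMul A F := FaithfulSMul.trans A K F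
  choose y hy using fun e : Edge n => IsAlgClosed.exists_pow_nat_eq
    (algebraMap A F (mP d n ℂ e)) (n := 2) (by norm_num)
  have heq : vanishingIdeal ℂ (Lvar d n) = RingHom.ker (aeval (R := ℂ) y) := by
    apply le_antisymm (vanishing_le (by omega) hy)
    intro f hf
    obtain ⟨h, hh⟩ := exists_decomp f
    rw [RingHom.mem_ker, aeval_y hy hh] at hf
    apply L_vanish_of_coeffs hh
    intro S
    have := kummer (K := K) (F := F) y (fun e => algebraMap A K (mP d n ℂ e))
      (fun e => (hy e).trans (IsScalarTower.algebraMap_apply A K F _))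
      (fun e => by
        rw [Ne, FaithfulSMul.algebraMap_eq_zero_iff]
        exact mP_ne_zero (by omega) e)
      (not_square_K hd) (fun S => algebraMap A K (aeval (mP d n ℂ) (h S)))
      (by
        rw [← hf]
        refine Finset.sum_congr rfl fun S _ => ?_
        rw [← IsScalarTower.algebraMap_apply A K F]) S
    exact (FaithfulSMul.algebraMap_eq_zero_iff A K).1 this
  rw [heq]
  exact RingHom.ker_isPrime _

theorem le_of_integral {R S : Type} [CommRing R] [CommRing S] (φ : R →+* S) (hφ : φ.IsIntegral)
    (I J : Ideal S) [I.IsPrime] (hIJ : I ≤ J) (h : J.comap φ ≤ I.comap φ) : J ≤ I := by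
  let := φ.toAlgebra
  intro x hx
  by_contra hxI
  have := Ideal.comap_lt_comap_of_integral_mem_sdiff (R := R) hIJ ⟨hx, hxI⟩ (hφ x)
  exact absurd h (not_le_of_gt this)

theorem expand_integral {ι : Type} : (expand (σ := ι) (R := ℚ) 2).toRingHom.IsIntegral := by
  intro f
  induction f using MvPolynomial.induction_on with
  | C a =>
    have : (C a : MvPolynomial ι ℚ) = (expand (σ := ι) (R := ℚ) 2).toRingHom (C a) := by
      simp
    rw [this]
    exact RingHom.isIntegralElem_map _
  | add p q hp hq => exact RingHom.IsIntegralElem.add _ hp hq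
  | mul_X p i hp =>
    refine RingHom.IsIntegralElem.mul _ hp ?_
    refine ⟨Polynomial.X ^ 2 - Polynomial.C (X i), Polynomial.monic_X_pow_sub_C _ two_ne_zero, ?_⟩
    simp [Polynomial.eval₂_sub]

theorem generic_of_sq {n d : ℕ} (hd : 2 ≤ d) (m : Edge n → ℂ) (hm : IsGenericPt (Mvar d n) m)
    (x : Edge n → ℂ) (hx : sqMap x = m) : IsGenericPt (Lvar d n) x := by
  have hxL : x ∈ Lvar d n := by
    change sqMap x ∈ Mvar d n
    rw [hx]; exact hm.1
  refine ⟨hxL, ?_⟩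
  have hcomap : vanishingIdeal ℚ (Lvar d n) =
      (vanishingIdeal ℂ (Lvar d n)).comap (map (algebraMap ℚ ℂ)) := by
    ext f
    simp [mem_vanishingIdeal_iff, aeval_map_algebraMap]
  have hp := vanishing_prime (n := n) hd
  have : (vanishingIdeal ℚ (Lvar d n)).IsPrime := by
    rw [hcomap]; exact Ideal.IsPrime.comap _
  have hle := le_of_integral _ (expand_integral (ι := Edge n)) (vanishingIdeal ℚ (Lvar d n))
    (RingHom.ker (aeval (R := ℚ) x)) (fun f hf => hf x hxL) (by
      intro f hf
      have h1 : aeval x (expand 2 f) = 0 := hf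
      rw [aeval_expand_two] at h1
      intro z hz
      change aeval z (expand 2 f) = 0
      rw [aeval_expand_two]
      exact hm.2 f (by rw [← hx]; exact h1) _ hz)
  exact fun f hf => hle hf

theorem generic_M {n d : ℕ} (p : Fin n → Fin d → ℝ) (hp : GenericConfig p) :
    IsGenericPt (Mvar d n) (fun e : Edge n => cSqLen (fun i k => ((p i k : ℝ) : ℂ)) e.val) := by
  refine ⟨⟨_, fun e => rfl⟩, ?_⟩
  intro f hf w hw
  have h1 := aeval_aeval_mP (k := ℚ) (fun ik : Fin n × Fin d => ((p ik.1 ik.2 : ℝ) : ℂ)) f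
  have h2 : aeval (fun ik : Fin n × Fin d => ((p ik.1 ik.2 : ℝ) : ℂ)) (aeval (mP d n ℚ) f) = 0 :=
    h1.trans hf
  have h3 : aeval (mP d n ℚ) f = 0 := by
    by_contra hne
    apply hp _ hne
    have h4 := aeval_algebraMap_apply ℂ (fun ik : Fin n × Fin d => p ik.1 ik.2) (aeval (mP d n ℚ) f)
    have h5 := h4.symm.trans h2
    exact (map_eq_zero (algebraMap ℝ ℂ)).1 h5
  obtain ⟨q, hq⟩ := hw
  have h6 := aeval_aeval_mP (k := ℚ) (fun ik : Fin n × Fin d => q ik.1 ik.2) f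
  rw [h3, map_zero] at h6
  rw [funext hq]
  exact h6.symm

theorem sq_lenR {n d : ℕ} (p : Fin n → Fin d → ℝ) :
    sqMap (fun e : Edge n => ((lenR p e.val : ℝ) : ℂ)) =
      fun e : Edge n => cSqLen (fun i k => ((p i k : ℝ) : ℂ)) e.val := by
  ext ⟨e, he⟩
  induction e using Sym2.ind with
  | _ i j =>
    change (((Real.sqrt (∑ k, (p i k - p j k) ^ 2) : ℝ)) : ℂ) ^ 2 =
      ∑ k, (((p i k : ℝ) : ℂ) - ((p j k : ℝ) : ℂ)) ^ 2
    rw [← Complex.ofReal_pow, Real.sq_sqrt (Finset.sum_nonneg fun k _ => sq_nonneg _)]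
    push_cast
    rfl

end irrsec

/-- For `n ≥ d+2`:  `L_{d,n}` is an algebraic variety of pure
dimension `d·n − C(d+1,2)` (every irreducible component has this dimension).
If moreover `d ≥ 2` then `L_{d,n}` is irreducible; every point of the fiber
`s⁻¹(m)` over a generic point `m` of `M_{d,n}` is generic in `L_{d,n}`; and the
length vector `l(p)` of a generic configuration `p` in ℝ^d is a generic point
of `L_{d,n}`. -/
theorem unsquared_measurement_variety_structure
    {d n : ℕ} (hd : 1 ≤ d) (hn : d + 2 ≤ n) :
    IsVariety (Lvar d n) ∧
    (∀ W : Set (Edge n → ℂ), IsComponent (Lvar d n) W →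
      varDim W = ((d * n - (d + 1).choose 2 : ℕ) : WithBot ℕ∞)) ∧
    (2 ≤ d →
      IsIrrVariety (Lvar d n) ∧
      (∀ m : Edge n → ℂ, IsGenericPt (Mvar d n) m →
        ∀ x : Edge n → ℂ, sqMap x = m → IsGenericPt (Lvar d n) x) ∧
      (∀ p : Fin n → Fin d → ℝ, GenericConfig p →
        IsGenericPt (Lvar d n) (fun e => ((lenR p e.val : ℝ) : ℂ)))) := by
  obtain ⟨r, rfl⟩ : ∃ r, n = d + r + 1 := ⟨n - d - 1, by omega⟩
  have hL : IsVariety (Lvar d (d + r + 1)) := isVariety_L d (d + r)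
  refine ⟨hL, ?_, ?_⟩
  · intro W hW
    have : FaithfulSMul (MvPolynomial (Fin (d + r + 1) × Fin d) ℂ)
        (AlgebraicClosure (FractionRing (MvPolynomial (Fin (d + r + 1) × Fin d) ℂ))) :=
      FaithfulSMul.trans _ (FractionRing (MvPolynomial (Fin (d + r + 1) × Fin d) ℂ)) _
    choose y hy using fun e : Edge (d + r + 1) => IsAlgClosed.exists_pow_nat_eq
      (algebraMap (MvPolynomial (Fin (d + r + 1) × Fin d) ℂ)
        (AlgebraicClosure (FractionRing (MvPolynomial (Fin (d + r + 1) × Fin d) ℂ)))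
        (mP d (d + r + 1) ℂ e)) (n := 2) (by norm_num)
    obtain ⟨z, hz, rfl⟩ := component_eq hd hy hL W hW
    have hpr : (RingHom.ker (MvPolynomial.aeval (R := ℂ) z)).IsPrime := RingHom.ker_isPrime _
    rw [varDim_zeroLocus]
    exact dim_y hz
  · intro hd2
    refine ⟨irr_iff.2 ⟨hL, vanishing_prime hd2⟩, fun m hm x hx => generic_of_sq hd2 m hm x hx, ?_⟩
    intro p hp
    exact generic_of_sq hd2 _ (generic_M p hp) _ (sq_lenR p)
end
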